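/- arXiv:2306.04638 — 2 statements merged into one kernel-verified Lean document; each statement's English description precedes it below -/
import Mathlib

section
/- The convergent series ∑_{k=1}^∞ (H_{3k} − H_k)/(k²·2^k·C(3k,k)) equals 11·ζ(3)/4 − π·G − π²·(log 2)/24, where ζ(3) = ∑_{n=1}^∞ 1/n³ and G is Catalan's constant. -/
open scoped BigOperators

/-- The `m`-th harmonic number `H_m = ∑_{j=1}^m 1/j`. -/
noncomputable def harmonicNum (m : ℕ) : ℝ := ∑ j ∈ Finset.range m, 1 / (j + 1 : ℝ)

/-- Catalan's constant `G = ∑_{n=0}^∞ (-1)^n/(2n+1)²`. -/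
noncomputable def catalanG : ℝ := ∑' n : ℕ, (-1) ^ n / (2 * n + 1 : ℝ) ^ 2

/-- `ζ(3) = ∑_{n=1}^∞ 1/n³`. -/
noncomputable def zeta3 : ℝ := ∑' n : ℕ, 1 / (n + 1 : ℝ) ^ 3

open MeasureTheory Set Filter Topology

/-! ### Integration over an open interval -/

theorem integral_Ioo_eq_sub {F f : ℝ → ℝ} {a b : ℝ} (hab : a ≤ b)
    (hc : ContinuousOn F (Icc a b)) (hd : ∀ x ∈ Ioo a b, HasDerivAt F (f x) x)
    (hi : IntegrableOn f (Ioo a b)) : ∫ x in Ioo a b, f x = F b - F a := by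
  rw [← integral_Ioc_eq_integral_Ioo, ← intervalIntegral.integral_of_le hab]
  exact intervalIntegral.integral_eq_sub_of_hasDerivAt_of_le hab hc hd
    ((intervalIntegrable_iff_integrableOn_Ioo_of_le hab).2 hi)

theorem ContinuousOn.integrableOn_Ioo {f : ℝ → ℝ} {a b : ℝ}
    (hf : ContinuousOn f (Icc a b)) : IntegrableOn f (Ioo a b) :=
  hf.integrableOn_Icc.mono_set Ioo_subset_Icc_self

theorem integrableOn_Ioo_of_abs_le {f g : ℝ → ℝ} {a b : ℝ} (hf : Measurable f)
    (hg : IntegrableOn g (Ioo a b)) (h : ∀ x ∈ Ioo a b, |f x| ≤ g x) :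
    IntegrableOn f (Ioo a b) :=
  Integrable.mono' hg hf.aestronglyMeasurable
    ((ae_restrict_iff' measurableSet_Ioo).2 (Eventually.of_forall h))

theorem HasDerivAt.congr_of_forall_eq {f g : ℝ → ℝ} {f' g' x : ℝ} (h : HasDerivAt f f' x)
    (hfg : ∀ y, g y = f y) (h' : g' = f') : HasDerivAt g g' x := by
  rw [h', funext hfg]; exact h

/-! ### Powers of the logarithm on the unit interval -/

theorem integrableOn_log_unit : IntegrableOn Real.log (Ioo 0 1) :=
  (intervalIntegrable_iff_integrableOn_Ioo_of_le zero_le_one).1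
    intervalIntegral.intervalIntegrable_log'

theorem integrableOn_log_sq_unit : IntegrableOn (fun x => Real.log x ^ 2) (Ioo 0 1) := by
  have h : IntegrableOn (fun x : ℝ => 16 * x ^ (-(1 / 2) : ℝ)) (Ioo 0 1) :=
    ((intervalIntegral.integrableOn_Ioo_rpow_iff one_pos).2 (by norm_num)).const_mul 16
  refine integrableOn_Ioo_of_abs_le (by fun_prop) h fun x hx => ?_
  have h1 := Real.abs_log_mul_self_rpow_lt x (1 / 4) hx.1 hx.2.le (by norm_num)
  have h2 : |Real.log x * x ^ (1 / 4 : ℝ)| ^ 2 ≤ 4 ^ 2 := by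
    gcongr
    linarith
  have h3 : (x ^ (1 / 4 : ℝ)) ^ 2 = x ^ (1 / 2 : ℝ) := by
    rw [← Real.rpow_natCast, ← Real.rpow_mul hx.1.le]; norm_num
  have h4 : x ^ (1 / 2 : ℝ) * x ^ (-(1 / 2) : ℝ) = 1 := by
    rw [← Real.rpow_add hx.1]; norm_num
  have h5 : 0 ≤ x ^ (-(1 / 2) : ℝ) := Real.rpow_nonneg hx.1.le _
  rw [sq_abs, mul_pow, h3] at h2
  rw [abs_of_nonneg (sq_nonneg _)]
  calc Real.log x ^ 2 = Real.log x ^ 2 * x ^ (1 / 2 : ℝ) * x ^ (-(1 / 2) : ℝ) := by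
        rw [mul_assoc, h4, mul_one]
    _ ≤ 4 ^ 2 * x ^ (-(1 / 2) : ℝ) := by gcongr
    _ = _ := by norm_num

theorem neg_log_div_one_sub_le {x : ℝ} (hx : x ∈ Ioo (0 : ℝ) 1) :
    -Real.log x / (1 - x) ≤ 1 - Real.log x := by
  have h0 := hx.1
  rw [div_le_iff₀ (by linarith [hx.2])]
  have := Real.one_sub_inv_le_log_of_pos hx.1
  have h2 : x * (1 - x⁻¹) ≤ x * Real.log x := by gcongr
  rw [mul_sub, mul_inv_cancel₀ h0.ne'] at h2
  nlinarith

theorem integrableOn_pow_mul_log (n : ℕ) :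
    IntegrableOn (fun x => x ^ n * Real.log x) (Ioo 0 1) := by
  refine integrableOn_Ioo_of_abs_le (by fun_prop) integrableOn_log_unit.abs fun x hx => ?_
  rw [abs_mul, abs_of_nonneg (pow_nonneg hx.1.le n)]
  exact mul_le_of_le_one_left (abs_nonneg _) (pow_le_one₀ hx.1.le hx.2.le)

theorem integrableOn_pow_mul_log_sq (n : ℕ) :
    IntegrableOn (fun x => x ^ n * Real.log x ^ 2) (Ioo 0 1) := by
  refine integrableOn_Ioo_of_abs_le (by fun_prop) integrableOn_log_sq_unit fun x hx => ?_
  rw [abs_mul, abs_of_nonneg (pow_nonneg hx.1.le n), abs_of_nonneg (sq_nonneg _)]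
  exact mul_le_of_le_one_left (sq_nonneg _) (pow_le_one₀ hx.1.le hx.2.le)

theorem integral_pow_mul_log (n : ℕ) :
    ∫ x in Ioo (0 : ℝ) 1, x ^ n * Real.log x = -(1 / (n + 1 : ℝ) ^ 2) := by
  have hn : (n + 1 : ℝ) ≠ 0 := by positivity
  have hc : Continuous fun x : ℝ =>
      x ^ n * (x * Real.log x) / (n + 1) - x ^ (n + 1) / (n + 1 : ℝ) ^ 2 :=
    (((continuous_pow n).mul Real.continuous_mul_log).div_const _).sub
      ((continuous_pow _).div_const _)
  rw [integral_Ioo_eq_sub zero_le_one hc.continuousOn _ (integrableOn_pow_mul_log n)]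
  · simp
  · intro x hx
    have hx0 := hx.1.ne'
    have h := (((hasDerivAt_pow (n + 1) x).mul (Real.hasDerivAt_log hx0)).div_const (n + 1 : ℝ)).sub
      ((hasDerivAt_pow (n + 1) x).div_const ((n + 1 : ℝ) ^ 2))
    refine h.congr_of_forall_eq (fun y => ?_) ?_
    · simp only [Pi.mul_apply, Pi.sub_apply]; ring
    · push_cast
      field_simp
      ring

theorem integral_pow_mul_log_sq (n : ℕ) :
    ∫ x in Ioo (0 : ℝ) 1, x ^ n * Real.log x ^ 2 = 2 / (n + 1 : ℝ) ^ 3 := by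
  have hn : (n + 1 : ℝ) ≠ 0 := by positivity
  have hlog : ContinuousOn (fun x : ℝ => x * Real.log x ^ 2) (Icc 0 1) := by
    have h : Continuous fun x : ℝ => 4 * (√x * Real.log √x) ^ 2 :=
      continuous_const.mul ((Real.continuous_mul_log.comp Real.continuous_sqrt).pow 2)
    refine h.continuousOn.congr fun x hx => ?_
    simp only
    rw [Real.log_sqrt hx.1, mul_pow, Real.sq_sqrt hx.1]
    ring
  have hc : ContinuousOn (fun x : ℝ => x ^ n * (x * Real.log x ^ 2) / (n + 1)
      - 2 * (x ^ n * (x * Real.log x)) / (n + 1 : ℝ) ^ 2 + 2 * x ^ (n + 1) / (n + 1 : ℝ) ^ 3)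
      (Icc 0 1) := by
    refine ContinuousOn.add (ContinuousOn.sub ?_ ?_) (by fun_prop)
    · exact ((continuous_pow n).continuousOn.mul hlog).div_const _
    · exact (continuous_const.mul
        ((continuous_pow n).mul Real.continuous_mul_log)).continuousOn.div_const _
  rw [integral_Ioo_eq_sub zero_le_one hc _ (integrableOn_pow_mul_log_sq n)]
  · simp
  · intro x hx
    have hx0 := hx.1.ne'
    have hl := Real.hasDerivAt_log hx0
    have hp := hasDerivAt_pow (n + 1) x
    have h := (((hp.mul (hl.pow 2)).div_const (n + 1 : ℝ)).sub
      (((hp.mul hl).const_mul 2).div_const ((n + 1 : ℝ) ^ 2))).add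
      ((hp.const_mul 2).div_const ((n + 1 : ℝ) ^ 3))
    refine h.congr_of_forall_eq (fun y => ?_) ?_
    · simp only [Pi.mul_apply, Pi.sub_apply, Pi.add_apply, Pi.pow_apply]; ring
    · push_cast
      simp only [Pi.pow_apply]
      field_simp
      ring

/-! ### The series as an integral -/

theorem harmonicNum_succ (m : ℕ) : harmonicNum (m + 1) = harmonicNum m + 1 / (m + 1 : ℝ) := by
  simp [harmonicNum, Finset.sum_range_succ]

theorem integrableOn_pow_mul_one_sub_pow_mul_log (m n : ℕ) :
    IntegrableOn (fun x => x ^ m * (1 - x) ^ n * Real.log x) (Ioo 0 1) := by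
  refine integrableOn_Ioo_of_abs_le (by fun_prop) integrableOn_log_unit.abs fun x hx => ?_
  have h1 : 0 ≤ 1 - x := by linarith [hx.2]
  rw [abs_mul, abs_of_nonneg (mul_nonneg (pow_nonneg hx.1.le m) (pow_nonneg h1 n))]
  refine mul_le_of_le_one_left (abs_nonneg _) (mul_le_one₀ (pow_le_one₀ hx.1.le hx.2.le)
    (pow_nonneg h1 n) (pow_le_one₀ h1 (by linarith [hx.1])))

theorem integral_pow_mul_one_sub_pow_mul_log (m n : ℕ) :
    ∫ x in Ioo (0 : ℝ) 1, x ^ m * (1 - x) ^ n * Real.log x =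
      -((harmonicNum (m + n + 1) - harmonicNum m) * (m.factorial * n.factorial) /
        (m + n + 1).factorial) := by
  induction n generalizing m with
  | zero =>
    simp only [pow_zero, mul_one, integral_pow_mul_log, harmonicNum_succ, Nat.factorial_succ,
      add_zero, Nat.factorial_zero]
    have := Nat.factorial_ne_zero m
    push_cast
    field_simp
    ring
  | succ n ih =>
    have h : ∀ x : ℝ, x ^ m * (1 - x) ^ (n + 1) * Real.log x =
        x ^ m * (1 - x) ^ n * Real.log x - x ^ (m + 1) * (1 - x) ^ n * Real.log x := by
      intro x; ring
    simp_rw [h]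
    rw [integral_sub (integrableOn_pow_mul_one_sub_pow_mul_log m n)
      (integrableOn_pow_mul_one_sub_pow_mul_log (m + 1) n), ih, ih,
      show m + 1 + n + 1 = (m + n + 1) + 1 by ring, show m + (n + 1) + 1 = (m + n + 1) + 1 by ring,
      harmonicNum_succ (m + n + 1), harmonicNum_succ m, Nat.factorial_succ (m + n + 1),
      Nat.factorial_succ m, Nat.factorial_succ n]
    have h1 := Nat.factorial_ne_zero (m + n + 1)
    push_cast
    field_simp
    ring

theorem tsum_eq_integral_log_mul_log :
    ∑' k : ℕ, (harmonicNum (3 * (k + 1)) - harmonicNum (k + 1)) /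
        ((k + 1 : ℝ) ^ 2 * 2 ^ (k + 1) * (Nat.choose (3 * (k + 1)) (k + 1) : ℝ)) =
      ∫ x in Ioo (0 : ℝ) 1,
        2 * Real.log x / (1 - x) * Real.log (1 - x * (1 - x) ^ 2 / 2) := by
  set F : ℕ → ℝ → ℝ := fun k x =>
    (-2 / ((k + 1) * 2 ^ (k + 1))) * (x ^ (k + 1) * (1 - x) ^ (2 * k + 1) * Real.log x) with hF
  have hint : ∀ k, IntegrableOn (F k) (Ioo 0 1) := fun k =>
    (integrableOn_pow_mul_one_sub_pow_mul_log _ _).const_mul _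
  have hval : ∀ k : ℕ, (harmonicNum (3 * (k + 1)) - harmonicNum (k + 1)) /
        ((k + 1 : ℝ) ^ 2 * 2 ^ (k + 1) * (Nat.choose (3 * (k + 1)) (k + 1) : ℝ)) =
      ∫ x in Ioo (0 : ℝ) 1, F k x := by
    intro k
    rw [hF]
    simp only
    rw [integral_const_mul, integral_pow_mul_one_sub_pow_mul_log,
      Nat.cast_choose ℝ (show k + 1 ≤ 3 * (k + 1) by omega),
      show k + 1 + (2 * k + 1) + 1 = 3 * (k + 1) by ring,
      show 3 * (k + 1) - (k + 1) = (2 * k + 1) + 1 by omega, Nat.factorial_succ (2 * k + 1)]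
    have h1 := Nat.factorial_ne_zero (3 * (k + 1))
    have h2 := Nat.factorial_ne_zero (k + 1)
    have h3 := Nat.factorial_ne_zero (2 * k + 1)
    push_cast
    field_simp
    ring
  have hnonneg : ∀ k, ∀ x ∈ Ioo (0 : ℝ) 1, ‖F k x‖ ≤ (1 / 2) ^ k * |Real.log x| := by
    intro k x hx
    have h1 : 0 ≤ 1 - x := by linarith [hx.2]
    have h2 : x ^ (k + 1) * (1 - x) ^ (2 * k + 1) ≤ 1 :=
      mul_le_one₀ (pow_le_one₀ hx.1.le hx.2.le) (pow_nonneg h1 _)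
        (pow_le_one₀ h1 (by linarith [hx.1]))
    have h3 : |(-2 / ((k + 1 : ℝ) * 2 ^ (k + 1)))| ≤ (1 / 2) ^ k := by
      rw [abs_div, abs_neg, abs_two, abs_of_pos (by positivity), div_le_iff₀ (by positivity),
        pow_succ, one_div, inv_pow]
      field_simp
      linarith [show (0 : ℝ) ≤ k by positivity]
    rw [hF, Real.norm_eq_abs]
    simp only
    rw [abs_mul, abs_mul, abs_of_nonneg (mul_nonneg (pow_nonneg hx.1.le _) (pow_nonneg h1 _))]
    calc _ ≤ (1 / 2) ^ k * (1 * |Real.log x|) :=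
          mul_le_mul h3 (mul_le_mul_of_nonneg_right h2 (abs_nonneg _))
            (by have := hx.1.le; positivity) (by positivity)
      _ = _ := by ring
  have hsum : Summable fun k => ∫ x in Ioo (0 : ℝ) 1, ‖F k x‖ := by
    refine Summable.of_nonneg_of_le (fun k => integral_nonneg fun x => norm_nonneg _)
      (fun k => ?_) ((summable_geometric_of_lt_one (by norm_num)
        (by norm_num : (1 / 2 : ℝ) < 1)).mul_right (∫ x in Ioo (0 : ℝ) 1, |Real.log x|))
    rw [← integral_const_mul]
    exact setIntegral_mono_on (hint k).norm (integrableOn_log_unit.abs.const_mul _)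
      measurableSet_Ioo (hnonneg k)
  simp_rw [hval]
  rw [(hasSum_integral_of_summable_integral_norm hint hsum).tsum_eq]
  refine setIntegral_congr_fun measurableSet_Ioo fun x hx => ?_
  have h1 : 0 < 1 - x := by linarith [hx.2]
  have hy : |x * (1 - x) ^ 2 / 2| < 1 := by
    have h2 : x * (1 - x) ^ 2 ≤ 1 :=
      mul_le_one₀ hx.2.le (sq_nonneg _) (pow_le_one₀ h1.le (by linarith [hx.1]))
    rw [abs_of_nonneg (div_nonneg (mul_nonneg hx.1.le (sq_nonneg _)) zero_le_two)]
    linarith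
  have h := (Real.hasSum_pow_div_log_of_abs_lt_one hy).mul_left (-2 * Real.log x / (1 - x))
  have h' : HasSum (fun k => F k x)
      (-2 * Real.log x / (1 - x) * -Real.log (1 - x * (1 - x) ^ 2 / 2)) := by
    refine h.congr_fun ?_
    intro k
    rw [hF]
    simp only [div_pow, mul_pow, ← pow_mul]
    rw [show 2 * (k + 1) = 2 * k + 1 + 1 by ring, pow_succ (1 - x) (2 * k + 1)]
    field_simp
  rw [h'.tsum_eq]
  ring

/-! ### Sums over odd integers and alternating sums -/

theorem hasSum_one_div_odd_pow {s : ℕ} {Z : ℝ}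
    (h : HasSum (fun n : ℕ => 1 / (n + 1 : ℝ) ^ s) Z) :
    HasSum (fun n : ℕ => 1 / (2 * n + 1 : ℝ) ^ s) ((1 - 1 / 2 ^ s) * Z) := by
  have he : Summable fun n : ℕ => 1 / (2 * n + 1 : ℝ) ^ s := by
    have := h.summable.comp_injective (mul_right_injective₀ (two_ne_zero (α := ℕ)))
    simpa [Function.comp_def] using this
  have ho : HasSum (fun n : ℕ => 1 / (((2 * n + 1 : ℕ) : ℝ) + 1) ^ s) (1 / 2 ^ s * Z) := by
    refine (h.mul_left (1 / 2 ^ s)).congr_fun fun n => ?_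
    push_cast
    rw [div_mul_div_comm, one_mul, ← mul_pow]
    ring
  have he' : HasSum (fun n : ℕ => 1 / (((2 * n : ℕ) : ℝ) + 1) ^ s)
      (∑' n : ℕ, 1 / (2 * n + 1 : ℝ) ^ s) := by
    simpa using he.hasSum
  have := (HasSum.even_add_odd (f := fun n : ℕ => 1 / (n + 1 : ℝ) ^ s) he' ho).unique h
  convert he.hasSum using 1
  linarith

theorem hasSum_neg_one_pow_div_pow {s : ℕ} {Z : ℝ}
    (h : HasSum (fun n : ℕ => 1 / (n + 1 : ℝ) ^ s) Z) :
    HasSum (fun n : ℕ => (-1) ^ n / (n + 1 : ℝ) ^ s) ((1 - 2 / 2 ^ s) * Z) := by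
  have ho : HasSum (fun n : ℕ => (-1) ^ (2 * n + 1) / (((2 * n + 1 : ℕ) : ℝ) + 1) ^ s)
      (-(1 / 2 ^ s) * Z) := by
    refine (h.mul_left (-(1 / 2 ^ s))).congr_fun fun n => ?_
    push_cast
    rw [pow_succ, pow_mul, neg_mul, div_mul_div_comm, one_mul, ← mul_pow]
    norm_num
    ring
  have he : HasSum (fun n : ℕ => (-1) ^ (2 * n) / (((2 * n : ℕ) : ℝ) + 1) ^ s)
      ((1 - 1 / 2 ^ s) * Z) := by
    refine (hasSum_one_div_odd_pow h).congr_fun fun n => ?_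
    simp [pow_mul]
  convert HasSum.even_add_odd (f := fun n : ℕ => (-1 : ℝ) ^ n / (n + 1 : ℝ) ^ s) he ho using 1
  ring

theorem hasSum_zeta3 : HasSum (fun n : ℕ => 1 / (n + 1 : ℝ) ^ 3) zeta3 := by
  have h := (summable_nat_add_iff 1).2 (Real.summable_one_div_nat_pow.2 (by norm_num : 1 < 3))
  have h' : Summable fun n : ℕ => 1 / (n + 1 : ℝ) ^ 3 := by simpa using h
  exact h'.hasSum

theorem hasSum_one_div_succ_sq :
    HasSum (fun n : ℕ => 1 / (n + 1 : ℝ) ^ 2) (Real.pi ^ 2 / 6) := by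
  have h := (hasSum_nat_add_iff' 1).2 hasSum_zeta_two
  simpa using h

/-! ### Integrals of products of two logarithms -/

theorem integral_log_sq_div_one_sub_pow {p : ℕ} (hp : p ≠ 0) {Z : ℝ}
    (h : HasSum (fun n : ℕ => 1 / (p * n + 1 : ℝ) ^ 3) Z) :
    ∫ x in Ioo (0 : ℝ) 1, Real.log x ^ 2 / (1 - x ^ p) = 2 * Z := by
  have hval : ∀ n : ℕ, ∫ x in Ioo (0 : ℝ) 1, x ^ (p * n) * Real.log x ^ 2 =
      2 * (1 / (p * n + 1 : ℝ) ^ 3) := by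
    intro n
    rw [integral_pow_mul_log_sq]
    push_cast
    ring
  have hint : ∀ n : ℕ, IntegrableOn (fun x => x ^ (p * n) * Real.log x ^ 2) (Ioo 0 1) :=
    fun n => integrableOn_pow_mul_log_sq _
  have hsum : Summable fun n : ℕ => ∫ x in Ioo (0 : ℝ) 1, ‖x ^ (p * n) * Real.log x ^ 2‖ := by
    refine (h.summable.mul_left 2).congr fun n => ?_
    rw [← hval]
    refine setIntegral_congr_fun measurableSet_Ioo fun x hx => ?_
    exact (Real.norm_of_nonneg (mul_nonneg (pow_nonneg hx.1.le _) (sq_nonneg _))).symm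
  have key := hasSum_integral_of_summable_integral_norm hint hsum
  simp_rw [hval] at key
  rw [(h.mul_left 2).unique key]
  refine setIntegral_congr_fun measurableSet_Ioo fun x hx => ?_
  have hx1 : x ^ p < 1 := pow_lt_one₀ hx.1.le hx.2 hp
  simp only [pow_mul, tsum_mul_right]
  rw [tsum_geometric_of_lt_one (pow_nonneg hx.1.le _) hx1]
  ring

theorem integral_Ioo_eq_integral_comp {φ φ' : ℝ → ℝ} {s t : Set ℝ} (hs : MeasurableSet s)
    (hd : ∀ x ∈ s, HasDerivAt φ (φ' x) x) (hinj : InjOn φ s) (himg : φ '' s = t)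
    (g : ℝ → ℝ) : ∫ x in t, g x = ∫ x in s, |φ' x| * g (φ x) := by
  rw [← himg]
  exact integral_image_eq_integral_abs_deriv_smul hs
    (fun x hx => (hd x hx).hasDerivWithinAt) hinj g

theorem image_one_sub_Ioo : (fun x : ℝ => 1 - x) '' Ioo 0 1 = Ioo 0 1 := by
  simp

theorem hasDerivAt_one_sub (x : ℝ) : HasDerivAt (fun x : ℝ => 1 - x) (-1) x := by
  simpa using (hasDerivAt_id x).const_sub 1

theorem integral_unit_comp_one_sub (g : ℝ → ℝ) :
    ∫ x in Ioo (0 : ℝ) 1, g x = ∫ x in Ioo (0 : ℝ) 1, g (1 - x) := by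
  rw [integral_Ioo_eq_integral_comp measurableSet_Ioo (fun x _ => hasDerivAt_one_sub x)
    (fun x _ y _ h => by simpa using h) image_one_sub_Ioo g]
  simp

theorem integrableOn_unit_comp_one_sub {g : ℝ → ℝ} (hg : IntegrableOn g (Ioo 0 1)) :
    IntegrableOn (fun x => g (1 - x)) (Ioo 0 1) := by
  rw [← image_one_sub_Ioo, integrableOn_image_iff_integrableOn_abs_deriv_smul measurableSet_Ioo
    (fun x _ => (hasDerivAt_one_sub x).hasDerivWithinAt) (fun x _ y _ h => by simpa using h)] at hg
  simpa using hg

theorem integral_unit_comp_sq (g : ℝ → ℝ) :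
    ∫ x in Ioo (0 : ℝ) 1, g x = ∫ x in Ioo (0 : ℝ) 1, 2 * x * g (x ^ 2) := by
  rw [integral_Ioo_eq_integral_comp (φ := fun x => x ^ 2) (φ' := fun x => 2 * x)
    measurableSet_Ioo (fun x _ => by simpa using hasDerivAt_pow 2 x)
    (fun x hx y hy h => (pow_left_inj₀ hx.1.le hy.1.le two_ne_zero).1 h) _ g]
  · exact setIntegral_congr_fun measurableSet_Ioo fun x hx => by
      rw [abs_of_pos (by linarith [hx.1])]
  · ext y
    constructor
    · rintro ⟨x, hx, rfl⟩
      exact ⟨pow_pos hx.1 2, pow_lt_one₀ hx.1.le hx.2 two_ne_zero⟩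
    · intro hy
      refine ⟨√y, ⟨Real.sqrt_pos.2 hy.1, ?_⟩, Real.sq_sqrt hy.1.le⟩
      rw [Real.sqrt_lt' one_pos]
      simpa using hy.2

theorem integral_unit_comp_cayley (g : ℝ → ℝ) :
    ∫ x in Ioo (0 : ℝ) 1, g x =
      ∫ x in Ioo (0 : ℝ) 1, 2 / (1 + x) ^ 2 * g ((1 - x) / (1 + x)) := by
  have hd : ∀ x ∈ Ioo (0 : ℝ) 1,
      HasDerivAt (fun x : ℝ => (1 - x) / (1 + x)) (-2 / (1 + x) ^ 2) x := by
    intro x hx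
    have hx0 : 1 + x ≠ 0 := by linarith [hx.1]
    refine ((hasDerivAt_one_sub x).div ((hasDerivAt_id x).const_add 1) hx0).congr_of_forall_eq
      (fun y => rfl) ?_
    simp only [id]
    ring
  have hinj : InjOn (fun x : ℝ => (1 - x) / (1 + x)) (Ioo 0 1) := by
    intro x hx y hy h
    have hx0 : 1 + x ≠ 0 := by linarith [hx.1]
    have hy0 : 1 + y ≠ 0 := by linarith [hy.1]
    simp only at h
    field_simp at h
    linarith
  have himg : (fun x : ℝ => (1 - x) / (1 + x)) '' Ioo 0 1 = Ioo 0 1 := by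
    have hmem : ∀ x ∈ Ioo (0 : ℝ) 1, (1 - x) / (1 + x) ∈ Ioo (0 : ℝ) 1 := by
      intro x hx
      have h1 : 0 < 1 + x := by linarith [hx.1]
      exact ⟨div_pos (by linarith [hx.2]) h1, by rw [div_lt_one h1]; linarith [hx.1]⟩
    ext y
    constructor
    · rintro ⟨x, hx, rfl⟩
      exact hmem x hx
    · intro hy
      refine ⟨_, hmem y hy, ?_⟩
      have h1 : 1 + y ≠ 0 := by linarith [hy.1]
      have h2 : 1 + (1 - y) / (1 + y) = 2 / (1 + y) := by field_simp; ring
      simp only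
      rw [h2]
      field_simp
      ring
  rw [integral_Ioo_eq_integral_comp measurableSet_Ioo hd hinj himg g]
  exact setIntegral_congr_fun measurableSet_Ioo fun x hx => by
    rw [abs_div, abs_neg, abs_two, abs_of_nonneg (sq_nonneg _)]

theorem integrableOn_log_sq_div_one_sub :
    IntegrableOn (fun x => Real.log x ^ 2 / (1 - x)) (Ioo 0 1) := by
  refine integrableOn_Ioo_of_abs_le (by fun_prop)
    (integrableOn_log_sq_unit.sub integrableOn_log_unit) fun x hx => ?_
  have h1 : 0 < 1 - x := by linarith [hx.2]
  have h2 : 0 ≤ -Real.log x := by linarith [Real.log_neg hx.1 hx.2]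
  rw [abs_of_nonneg (div_nonneg (sq_nonneg _) h1.le)]
  calc Real.log x ^ 2 / (1 - x) = -Real.log x * (-Real.log x / (1 - x)) := by ring
    _ ≤ -Real.log x * (1 - Real.log x) := by gcongr; exact neg_log_div_one_sub_le hx
    _ = _ := by simp only [Pi.sub_apply]; ring

theorem integrableOn_log_one_sub_sq_div :
    IntegrableOn (fun x => Real.log (1 - x) ^ 2 / x) (Ioo 0 1) := by
  simpa using integrableOn_unit_comp_one_sub integrableOn_log_sq_div_one_sub

theorem log_one_add_mem {x : ℝ} (hx : x ∈ Ioo (0 : ℝ) 1) :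
    0 ≤ Real.log (1 + x) ∧ Real.log (1 + x) ≤ x :=
  ⟨Real.log_nonneg (by linarith [hx.1]), by
    linarith [Real.log_le_sub_one_of_pos (show 0 < 1 + x by linarith [hx.1])]⟩

theorem integrableOn_log_one_add_sq_div :
    IntegrableOn (fun x => Real.log (1 + x) ^ 2 / x) (Ioo 0 1) := by
  refine integrableOn_Ioo_of_abs_le (g := fun x => x) (by fun_prop)
    continuous_id.continuousOn.integrableOn_Ioo fun x hx => ?_
  obtain ⟨h0, h1⟩ := log_one_add_mem hx
  rw [abs_of_nonneg (div_nonneg (sq_nonneg _) hx.1.le), div_le_iff₀ hx.1]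
  nlinarith

theorem integrableOn_log_one_sub_mul_log_one_add_div :
    IntegrableOn (fun x => Real.log (1 - x) * Real.log (1 + x) / x) (Ioo 0 1) := by
  refine integrableOn_Ioo_of_abs_le (by fun_prop)
    (integrableOn_unit_comp_one_sub integrableOn_log_unit).abs fun x hx => ?_
  obtain ⟨h0, h1⟩ := log_one_add_mem hx
  rw [abs_div, abs_mul, abs_of_nonneg h0, abs_of_pos hx.1, div_le_iff₀ hx.1]
  gcongr

theorem integral_log_one_sub_sq_div :
    ∫ x in Ioo (0 : ℝ) 1, Real.log (1 - x) ^ 2 / x = 2 * zeta3 := by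
  have h := integral_log_sq_div_one_sub_pow one_ne_zero (Z := zeta3) (by simpa using hasSum_zeta3)
  rw [integral_unit_comp_one_sub] at h
  simpa using h

theorem integral_log_add_sq_div :
    ∫ x in Ioo (0 : ℝ) 1, (Real.log (1 - x) + Real.log (1 + x)) ^ 2 / x = zeta3 := by
  have h := integral_log_one_sub_sq_div
  rw [integral_unit_comp_sq] at h
  have h2 : ∫ x in Ioo (0 : ℝ) 1, 2 * x * (Real.log (1 - x ^ 2) ^ 2 / x ^ 2) =
      ∫ x in Ioo (0 : ℝ) 1, 2 * ((Real.log (1 - x) + Real.log (1 + x)) ^ 2 / x) := by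
    refine setIntegral_congr_fun measurableSet_Ioo fun x hx => ?_
    have hx0 := hx.1.ne'
    rw [show 1 - x ^ 2 = (1 - x) * (1 + x) by ring,
      Real.log_mul (by linarith [hx.2]) (by linarith [hx.1])]
    field_simp
  rw [h2, integral_const_mul] at h
  linarith

theorem integral_log_sub_sq_div :
    ∫ x in Ioo (0 : ℝ) 1, (Real.log (1 - x) - Real.log (1 + x)) ^ 2 / x = 7 / 2 * zeta3 := by
  have h := integral_log_sq_div_one_sub_pow two_ne_zero
    (by simpa using hasSum_one_div_odd_pow hasSum_zeta3)
  rw [integral_unit_comp_cayley] at h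
  have h2 : ∫ x in Ioo (0 : ℝ) 1, 2 / (1 + x) ^ 2 *
        (Real.log ((1 - x) / (1 + x)) ^ 2 / (1 - ((1 - x) / (1 + x)) ^ 2)) =
      ∫ x in Ioo (0 : ℝ) 1, 1 / 2 * ((Real.log (1 - x) - Real.log (1 + x)) ^ 2 / x) := by
    refine setIntegral_congr_fun measurableSet_Ioo fun x hx => ?_
    have hx0 := hx.1.ne'
    have hx1 : 1 + x ≠ 0 := by linarith [hx.1]
    rw [Real.log_div (by linarith [hx.2]) hx1,
      show 1 - ((1 - x) / (1 + x)) ^ 2 = 4 * x / (1 + x) ^ 2 by field_simp; ring]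
    field_simp
    ring
  rw [h2, integral_const_mul] at h
  linarith

theorem integral_log_add_smul_sq_div (c : ℝ) :
    ∫ x in Ioo (0 : ℝ) 1, (Real.log (1 - x) + c * Real.log (1 + x)) ^ 2 / x =
      2 * zeta3 + 2 * c * (∫ x in Ioo (0 : ℝ) 1, Real.log (1 - x) * Real.log (1 + x) / x) +
        c ^ 2 * ∫ x in Ioo (0 : ℝ) 1, Real.log (1 + x) ^ 2 / x := by
  have h1 := integrableOn_log_one_sub_sq_div
  have h2 := integrableOn_log_one_sub_mul_log_one_add_div.const_mul (2 * c)
  have h3 := integrableOn_log_one_add_sq_div.const_mul (c ^ 2)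
  rw [← integral_log_one_sub_sq_div, ← integral_const_mul, ← integral_const_mul]
  refine Eq.trans ?_ ((integral_add (h1.add h2) h3).trans
    (congrArg (· + _) (integral_add h1 h2)))
  congr 1
  funext x
  simp only [Pi.add_apply]
  ring

theorem integral_log_one_sub_mul_log_one_add_div :
    ∫ x in Ioo (0 : ℝ) 1, Real.log (1 - x) * Real.log (1 + x) / x = -(5 / 8) * zeta3 := by
  have h1 := integral_log_add_smul_sq_div 1
  have h2 := integral_log_add_smul_sq_div (-1)
  simp only [one_mul, neg_one_mul, ← sub_eq_add_neg, integral_log_add_sq_div,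
    integral_log_sub_sq_div] at h1 h2
  linarith

theorem integral_log_one_add_sq_div :
    ∫ x in Ioo (0 : ℝ) 1, Real.log (1 + x) ^ 2 / x = zeta3 / 4 := by
  have h1 := integral_log_add_smul_sq_div 1
  simp only [one_mul, integral_log_add_sq_div, integral_log_one_sub_mul_log_one_add_div] at h1
  linarith

theorem integral_log_one_add_sq_sq_div :
    ∫ x in Ioo (0 : ℝ) 1, Real.log (1 + x ^ 2) ^ 2 / x = zeta3 / 8 := by
  have h := integral_log_one_add_sq_div
  rw [integral_unit_comp_sq] at h
  have h2 : ∫ x in Ioo (0 : ℝ) 1, 2 * x * (Real.log (1 + x ^ 2) ^ 2 / x ^ 2) =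
      ∫ x in Ioo (0 : ℝ) 1, 2 * (Real.log (1 + x ^ 2) ^ 2 / x) := by
    refine setIntegral_congr_fun measurableSet_Ioo fun x hx => ?_
    have hx0 := hx.1.ne'
    field_simp
  rw [h2, integral_const_mul] at h
  linarith

theorem integral_log_mul_log_two_sub_div :
    ∫ x in Ioo (0 : ℝ) 1, Real.log x * Real.log (2 - x) / (1 - x) = -(5 / 8) * zeta3 := by
  rw [integral_unit_comp_one_sub, ← integral_log_one_sub_mul_log_one_add_div]
  congr 1
  funext x
  rw [show 2 - (1 - x) = 1 + x by ring, sub_sub_cancel]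

/-! ### Alternating polylogarithmic series -/

/-- The series `∑ (-1)^n * t^(2 * n + q) / (2 * n + q + 1)^s`. -/
noncomputable def altPolylog (s q : ℕ) (t : ℝ) : ℝ :=
  ∑' n : ℕ, (-1) ^ n * t ^ (2 * n + q) / (2 * n + q + 1 : ℝ) ^ s

theorem norm_altPolylog_term_le (s q n : ℕ) {t r : ℝ} (ht : 0 ≤ t) (htr : t ≤ r) (hr : r ≤ 1) :
    ‖(-1) ^ n * t ^ (2 * n + q) / (2 * n + q + 1 : ℝ) ^ s‖ ≤ r ^ n / (n + 1 : ℝ) ^ s := by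
  have hn : (0 : ℝ) ≤ n := n.cast_nonneg
  have hq : (0 : ℝ) ≤ q := q.cast_nonneg
  rw [norm_div, norm_mul, norm_pow, norm_neg, norm_one, one_pow, one_mul, Real.norm_eq_abs,
    Real.norm_eq_abs, abs_of_nonneg (pow_nonneg ht _), abs_of_pos (by positivity)]
  have h1 : t ^ (2 * n + q) ≤ r ^ n :=
    (pow_le_pow_of_le_one ht (htr.trans hr) (by omega)).trans (pow_le_pow_left₀ ht htr n)
  gcongr
  · exact pow_nonneg (ht.trans htr) _
  · linarith

theorem continuousOn_altPolylog {s : ℕ} (hs : 2 ≤ s) (q : ℕ) :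
    ContinuousOn (altPolylog s q) (Icc 0 1) := by
  have hsum : Summable fun n : ℕ => (1 : ℝ) ^ n / (n + 1 : ℝ) ^ s := by
    have h := (summable_nat_add_iff 1).2 (Real.summable_one_div_nat_pow.2 (by omega : 1 < s))
    simpa using h
  exact continuousOn_tsum (fun n => by fun_prop) hsum
    fun n t ht => norm_altPolylog_term_le s q n ht.1 ht.2 le_rfl

theorem hasDerivAt_mul_altPolylog (s q : ℕ) {t : ℝ} (ht : t ∈ Ioo (0 : ℝ) 1) :
    HasDerivAt (fun t => t * altPolylog (s + 1) q t) (altPolylog s q t) t := by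
  obtain ⟨r, htr, hr⟩ := exists_between ht.2
  have hr0 : 0 ≤ r := ht.1.le.trans htr.le
  have hgeom : Summable fun n : ℕ => r ^ n := summable_geometric_of_lt_one hr0 hr
  have hterm : ∀ s n : ℕ, ∀ y ∈ Ioo 0 r,
      ‖(-1) ^ n * y ^ (2 * n + q) / (2 * n + q + 1 : ℝ) ^ s‖ ≤ r ^ n := by
    intro s n y hy
    refine (norm_altPolylog_term_le s q n hy.1.le hy.2.le hr.le).trans
      (div_le_self (pow_nonneg hr0 n) (one_le_pow₀ ?_))
    linarith [show (0 : ℝ) ≤ n from n.cast_nonneg]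
  have hsummable : ∀ s, ∀ y ∈ Ioo 0 r,
      Summable fun n : ℕ => (-1) ^ n * y ^ (2 * n + q) / (2 * n + q + 1 : ℝ) ^ s :=
    fun s y hy => Summable.of_norm_bounded hgeom fun n => hterm s n y hy
  have key := hasDerivAt_tsum_of_isPreconnected
    (g := fun (n : ℕ) (y : ℝ) => y * ((-1) ^ n * y ^ (2 * n + q) / (2 * n + q + 1 : ℝ) ^ (s + 1)))
    (g' := fun (n : ℕ) (y : ℝ) => (-1) ^ n * y ^ (2 * n + q) / (2 * n + q + 1 : ℝ) ^ s)
    hgeom isOpen_Ioo isPreconnected_Ioo (fun n y _ => ?_) (hterm s) ⟨ht.1, htr⟩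
    ((hsummable (s + 1) t ⟨ht.1, htr⟩).mul_left t) ⟨ht.1, htr⟩
  · simp only [tsum_mul_left] at key
    exact key
  · have hn : (2 * n + q + 1 : ℝ) ≠ 0 := by positivity
    refine (((hasDerivAt_pow (2 * n + q + 1) y).const_mul ((-1 : ℝ) ^ n)).div_const
      ((2 * n + q + 1 : ℝ) ^ (s + 1))).congr_of_forall_eq (fun y => by ring) ?_
    push_cast
    field_simp
    ring

theorem altPolylog_one_zero {t : ℝ} (ht : t ∈ Ioo (0 : ℝ) 1) :
    altPolylog 1 0 t = Real.arctan t / t := by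
  have h := (Real.hasSum_arctan (x := t) (by
    rw [Real.norm_eq_abs, abs_of_pos ht.1]; exact ht.2)).div_const t
  refine HasSum.tsum_eq (h.congr_fun fun n => ?_)
  have := ht.1.ne'
  push_cast
  field_simp
  ring

theorem altPolylog_one_one {t : ℝ} (ht : t ∈ Ioo (0 : ℝ) 1) :
    altPolylog 1 1 t = Real.log (1 + t ^ 2) / (2 * t) := by
  have ht2 : |-t ^ 2| < 1 := by
    rw [abs_neg, abs_of_nonneg (sq_nonneg t)]
    exact pow_lt_one₀ ht.1.le ht.2 two_ne_zero
  have h := (Real.hasSum_pow_div_log_of_abs_lt_one ht2).mul_left (-1 / (2 * t))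
  rw [sub_neg_eq_add, show -1 / (2 * t) * -Real.log (1 + t ^ 2) =
    Real.log (1 + t ^ 2) / (2 * t) by ring] at h
  refine HasSum.tsum_eq (h.congr_fun fun n => ?_)
  have := ht.1.ne'
  have hn : (n + 1 : ℝ) ≠ 0 := by positivity
  have hn2 : (2 * n + 1 + 1 : ℝ) ≠ 0 := by positivity
  rw [neg_pow (t ^ 2), pow_succ (-1 : ℝ) n]
  push_cast
  field_simp
  ring

theorem integral_pow_mul_log_div (q : ℕ) {t : ℝ} (ht : t ∈ Ioo (0 : ℝ) 1) :
    ∫ x in Ioo (0 : ℝ) 1, x ^ q * Real.log x / (1 + t ^ 2 * x ^ 2) =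
      -(altPolylog 2 q t / t ^ q) := by
  have ht0 := ht.1.ne'
  have ht2 : t ^ 2 < 1 := pow_lt_one₀ ht.1.le ht.2 two_ne_zero
  set F : ℕ → ℝ → ℝ := fun n x => (-t ^ 2) ^ n * (x ^ (2 * n + q) * Real.log x) with hF
  have hint : ∀ n, IntegrableOn (F n) (Ioo 0 1) :=
    fun n => (integrableOn_pow_mul_log _).const_mul _
  have hsum : Summable fun n => ∫ x in Ioo (0 : ℝ) 1, ‖F n x‖ := by
    refine Summable.of_nonneg_of_le (fun k => integral_nonneg fun x => norm_nonneg _)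
      (fun n => ?_) ((summable_geometric_of_lt_one (sq_nonneg t) ht2).mul_right
        (∫ x in Ioo (0 : ℝ) 1, |Real.log x|))
    rw [← integral_const_mul]
    refine setIntegral_mono_on (hint n).norm (integrableOn_log_unit.abs.const_mul _)
      measurableSet_Ioo fun x hx => ?_
    rw [hF, Real.norm_eq_abs]
    simp only
    rw [abs_mul, abs_mul, abs_pow, abs_neg, abs_of_nonneg (sq_nonneg t),
      abs_of_nonneg (pow_nonneg hx.1.le _)]
    gcongr
    exact mul_le_of_le_one_left (abs_nonneg _) (pow_le_one₀ hx.1.le hx.2.le)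
  have key := hasSum_integral_of_summable_integral_norm hint hsum
  have hval : ∀ n : ℕ, ∫ x in Ioo (0 : ℝ) 1, F n x =
      -(1 / t ^ q) * ((-1) ^ n * t ^ (2 * n + q) / (2 * n + q + 1 : ℝ) ^ 2) := by
    intro n
    rw [hF]
    simp only
    rw [integral_const_mul, integral_pow_mul_log, neg_pow, pow_add, pow_mul]
    push_cast
    field_simp
  simp_rw [hval] at key
  have hI : ∫ x in Ioo (0 : ℝ) 1, x ^ q * Real.log x / (1 + t ^ 2 * x ^ 2) =
      ∫ x in Ioo (0 : ℝ) 1, ∑' n, F n x := by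
    refine setIntegral_congr_fun measurableSet_Ioo fun x hx => ?_
    have hx2 : x ^ 2 < 1 := pow_lt_one₀ hx.1.le hx.2 two_ne_zero
    have hlt : |-(t ^ 2 * x ^ 2)| < 1 := by
      rw [abs_neg, abs_of_nonneg (by positivity)]
      exact mul_lt_one_of_nonneg_of_lt_one_left (sq_nonneg t) ht2 hx2.le
    have h := (hasSum_geometric_of_abs_lt_one hlt).mul_left (x ^ q * Real.log x)
    rw [sub_neg_eq_add] at h
    rw [div_eq_mul_inv, ← h.tsum_eq]
    refine tsum_congr fun n => ?_
    simp only [hF]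
    rw [pow_add, pow_mul, neg_pow, neg_pow (t ^ 2), mul_pow]
    ring
  rw [hI, ← key.tsum_eq, tsum_mul_left, altPolylog]
  ring

/-! ### The double integral -/

theorem log_mul_log_div_eq_integral {x : ℝ} (hx : x ∈ Ioo (0 : ℝ) 1) :
    Real.log x * Real.log ((1 + x ^ 2) / 2) / (1 - x) =
      ∫ t in Ioo (0 : ℝ) 1,
        -(2 * t / (1 + t ^ 2)) * ((1 + x) * Real.log x / (1 + t ^ 2 * x ^ 2)) := by
  have hx1 : 1 - x ≠ 0 := by linarith [hx.2]
  have h1 : ∀ t : ℝ, 1 + t ^ 2 ≠ 0 := fun t => by positivity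
  have h2 : ∀ t : ℝ, 1 + t ^ 2 * x ^ 2 ≠ 0 := fun t => by positivity
  rw [integral_Ioo_eq_sub (F := fun t => Real.log x / (1 - x) *
    (Real.log (1 + t ^ 2 * x ^ 2) - Real.log (1 + t ^ 2))) zero_le_one]
  · rw [Real.log_div (by positivity) two_ne_zero]
    norm_num
    ring
  · exact continuousOn_const.mul
      ((ContinuousOn.log (by fun_prop) fun t _ => h2 t).sub
        (ContinuousOn.log (by fun_prop) fun t _ => h1 t))
  · intro t _
    have hd1 : HasDerivAt (fun t : ℝ => 1 + t ^ 2 * x ^ 2) (2 * t * x ^ 2) t := by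
      simpa using ((hasDerivAt_pow 2 t).mul_const (x ^ 2)).const_add 1
    have hd2 : HasDerivAt (fun t : ℝ => 1 + t ^ 2) (2 * t) t := by
      simpa using (hasDerivAt_pow 2 t).const_add 1
    refine (((hd1.log (h2 t)).sub (hd2.log (h1 t))).const_mul
      (Real.log x / (1 - x))).congr_of_forall_eq (fun y => rfl) ?_
    have h1 := h1 t
    have h2 := h2 t
    field_simp
    ring
  · refine ContinuousOn.integrableOn_Ioo ?_
    exact (ContinuousOn.div (by fun_prop) (by fun_prop) fun t _ => h1 t).neg.mul
      (ContinuousOn.div (by fun_prop) (by fun_prop) fun t _ => h2 t)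

theorem integrable_log_kernel :
    Integrable (Function.uncurry fun x t : ℝ =>
      -(2 * t / (1 + t ^ 2)) * ((1 + x) * Real.log x / (1 + t ^ 2 * x ^ 2)))
      ((volume.restrict (Ioo (0 : ℝ) 1)).prod (volume.restrict (Ioo (0 : ℝ) 1))) := by
  have hlog : Integrable (fun x => 4 * |Real.log x|) (volume.restrict (Ioo (0 : ℝ) 1)) :=
    integrableOn_log_unit.abs.const_mul 4
  have hone : Integrable (fun _ : ℝ => (1 : ℝ)) (volume.restrict (Ioo (0 : ℝ) 1)) :=
    integrable_const _
  refine (hlog.mul_prod hone).mono' (Measurable.aestronglyMeasurable ?_) ?_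
  · unfold Function.uncurry
    fun_prop
  rw [Measure.prod_restrict]
  refine (ae_restrict_iff' (measurableSet_Ioo.prod measurableSet_Ioo)).2
    (Eventually.of_forall ?_)
  rintro ⟨x, t⟩ ⟨hx, ht⟩
  simp only [mem_Ioo] at hx ht
  simp only [Function.uncurry, mul_one, Real.norm_eq_abs]
  rw [abs_mul, abs_neg, abs_div, abs_div, abs_mul (1 + x), abs_of_pos (by linarith : 0 < 2 * t),
    abs_of_pos (by linarith : 0 < 1 + x), abs_of_pos (by positivity : 0 < 1 + t ^ 2),
    abs_of_pos (by positivity : 0 < 1 + t ^ 2 * x ^ 2)]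
  have h1 : 2 * t / (1 + t ^ 2) ≤ 2 :=
    (div_le_self (by linarith) (by nlinarith)).trans (by linarith)
  have h2 : (1 + x) * |Real.log x| / (1 + t ^ 2 * x ^ 2) ≤ 2 * |Real.log x| :=
    (div_le_self (mul_nonneg (by linarith) (abs_nonneg _))
      (by nlinarith [mul_nonneg (sq_nonneg t) (sq_nonneg x)])).trans
      (mul_le_mul_of_nonneg_right (by linarith) (abs_nonneg _))
  calc _ ≤ 2 * (2 * |Real.log x|) := by
        refine mul_le_mul h1 h2 (div_nonneg (mul_nonneg ?_ (abs_nonneg _)) ?_) zero_le_two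
        · linarith
        · positivity
    _ = _ := by ring

theorem integrableOn_pow_mul_log_div (q : ℕ) (t : ℝ) :
    IntegrableOn (fun x => x ^ q * Real.log x / (1 + t ^ 2 * x ^ 2)) (Ioo 0 1) := by
  refine integrableOn_Ioo_of_abs_le (by fun_prop) (integrableOn_pow_mul_log q).abs fun x hx => ?_
  rw [abs_div, abs_of_pos (by positivity : 0 < 1 + t ^ 2 * x ^ 2)]
  exact div_le_self (abs_nonneg _) (by nlinarith [mul_nonneg (sq_nonneg t) (sq_nonneg x)])

theorem integral_log_mul_log_div_eq_altPolylog :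
    ∫ x in Ioo (0 : ℝ) 1, Real.log x * Real.log ((1 + x ^ 2) / 2) / (1 - x) =
      ∫ t in Ioo (0 : ℝ) 1, (2 * t * altPolylog 2 0 t + 2 * altPolylog 2 1 t) / (1 + t ^ 2) := by
  rw [setIntegral_congr_fun measurableSet_Ioo fun x hx => log_mul_log_div_eq_integral hx,
    integral_integral_swap integrable_log_kernel]
  refine setIntegral_congr_fun measurableSet_Ioo fun t ht => ?_
  have hsplit : ∀ x : ℝ, (1 + x) * Real.log x / (1 + t ^ 2 * x ^ 2) =
      x ^ 0 * Real.log x / (1 + t ^ 2 * x ^ 2) + x ^ 1 * Real.log x / (1 + t ^ 2 * x ^ 2) := by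
    intro x; ring
  have ht0 := ht.1.ne'
  simp_rw [hsplit]
  rw [integral_const_mul, integral_add (integrableOn_pow_mul_log_div 0 t)
    (integrableOn_pow_mul_log_div 1 t), integral_pow_mul_log_div 0 ht,
    integral_pow_mul_log_div 1 ht]
  field_simp
  ring

/-! ### The integral of `arctan² t / t` -/

theorem integral_sq_mul_sin_odd (k : ℕ) :
    ∫ x in Ioo 0 (Real.pi / 2), x ^ 2 * Real.sin ((2 * k + 1) * x) =
      Real.pi * ((-1) ^ k / (2 * k + 1 : ℝ) ^ 2) - 2 * (1 / (2 * k + 1 : ℝ) ^ 3) := by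
  have hk : (2 * k + 1 : ℝ) ≠ 0 := by positivity
  have harg : (2 * k + 1 : ℝ) * (Real.pi / 2) = Real.pi / 2 + k * Real.pi := by ring
  rw [integral_Ioo_eq_sub (F := fun x => -(x ^ 2 * Real.cos ((2 * k + 1) * x) / (2 * k + 1)) +
    2 * x * Real.sin ((2 * k + 1) * x) / (2 * k + 1 : ℝ) ^ 2 +
    2 * Real.cos ((2 * k + 1) * x) / (2 * k + 1 : ℝ) ^ 3) (by positivity) (by fun_prop) _
    (ContinuousOn.integrableOn_Ioo (by fun_prop))]
  · rw [harg, Real.sin_add_nat_mul_pi, Real.cos_add_nat_mul_pi]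
    simp
    ring
  · intro x _
    have hl : HasDerivAt (fun x : ℝ => (2 * k + 1 : ℝ) * x) (2 * k + 1) x := by
      simpa using (hasDerivAt_id x).const_mul (2 * k + 1 : ℝ)
    have hs := hl.sin
    have hc := hl.cos
    have h2 : HasDerivAt (fun x : ℝ => x ^ 2) (2 * x) x := by simpa using hasDerivAt_pow 2 x
    have h1 : HasDerivAt (fun x : ℝ => 2 * x) 2 x := by
      simpa using (hasDerivAt_id x).const_mul (2 : ℝ)
    refine ((((h2.mul hc).div_const (2 * k + 1 : ℝ)).neg.add
      ((h1.mul hs).div_const ((2 * k + 1 : ℝ) ^ 2))).add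
      ((hc.const_mul 2).div_const ((2 * k + 1 : ℝ) ^ 3))).congr_of_forall_eq (fun y => rfl) ?_
    field_simp
    ring

theorem two_mul_sin_mul_sum_sin_odd (x : ℝ) (N : ℕ) :
    2 * Real.sin x * ∑ k ∈ Finset.range N, Real.sin ((2 * k + 1) * x) =
      1 - Real.cos (2 * N * x) := by
  induction N with
  | zero => simp
  | succ N ih =>
    rw [Finset.sum_range_succ, mul_add, ih]
    have h1 : Real.cos (2 * N * x) = Real.cos ((2 * N + 1) * x - x) := by congr 1; ring
    have h2 : Real.cos (2 * (N + 1 : ℕ) * x) = Real.cos ((2 * N + 1) * x + x) := by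
      congr 1; push_cast; ring
    rw [h1, h2, Real.cos_sub, Real.cos_add]
    ring

theorem integrableOn_sq_div_sin :
    IntegrableOn (fun x => x ^ 2 / Real.sin x) (Ioo 0 (Real.pi / 2)) := by
  refine integrableOn_Ioo_of_abs_le (g := fun x => Real.pi / 2 * x) (by fun_prop)
    (ContinuousOn.integrableOn_Ioo (by fun_prop)) fun x hx => ?_
  have h1 := Real.mul_le_sin hx.1.le hx.2.le
  have hs : 0 < Real.sin x :=
    Real.sin_pos_of_pos_of_lt_pi hx.1 (by linarith [hx.2, Real.pi_pos])
  have h2 : x ≤ Real.pi / 2 * Real.sin x := by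
    have := mul_le_mul_of_nonneg_left h1 (by positivity : 0 ≤ Real.pi / 2)
    have h3 : Real.pi / 2 * (2 / Real.pi * x) = x := by field_simp
    linarith
  rw [abs_of_pos (div_pos (pow_pos hx.1 2) hs), div_le_iff₀ hs]
  nlinarith [hx.1]

theorem tendsto_integral_mul_cos {f : ℝ → ℝ} {s : Set ℝ} (hs : MeasurableSet s)
    (hf : IntegrableOn f s) :
    Tendsto (fun N : ℕ => ∫ x in s, f x * Real.cos (2 * N * x)) atTop (𝓝 0) := by
  have h := Real.tendsto_integral_exp_smul_cocompact (fun x => ((s.indicator f x : ℝ) : ℂ))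
  have hw : Tendsto (fun N : ℕ => (N : ℝ) / Real.pi) atTop (cocompact ℝ) :=
    (tendsto_natCast_atTop_atTop.atTop_div_const Real.pi_pos).mono_right atTop_le_cocompact
  have h' := (Complex.continuous_re.tendsto 0).comp (h.comp hw)
  rw [Complex.zero_re] at h'
  refine h'.congr fun N => ?_
  have hind : Integrable (fun x => ((s.indicator f x : ℝ) : ℂ)) :=
    ((integrable_indicator_iff hs).2 hf).ofReal
  have hfun : ∀ v : ℝ, Real.fourierChar (-(v * (N / Real.pi))) • ((s.indicator f v : ℝ) : ℂ) =
      Complex.exp ((-(2 * N * v) : ℝ) * Complex.I) * ((s.indicator f v : ℝ) : ℂ) := by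
    intro v
    rw [Circle.smul_def, Real.fourierChar_apply, smul_eq_mul,
      show (2 * Real.pi * -(v * (N / Real.pi)) : ℝ) = -(2 * N * v) by field_simp]
  have hint : Integrable fun v : ℝ =>
      Complex.exp ((-(2 * N * v) : ℝ) * Complex.I) * ((s.indicator f v : ℝ) : ℂ) := by
    refine hind.bdd_mul (c := 1) (Continuous.aestronglyMeasurable (by fun_prop)) ?_
    exact Eventually.of_forall fun v => (Complex.norm_exp_ofReal_mul_I _).le
  have hre : (∫ v : ℝ, Complex.exp ((-(2 * N * v) : ℝ) * Complex.I) *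
      ((s.indicator f v : ℝ) : ℂ)).re = ∫ v : ℝ, (Complex.exp ((-(2 * N * v) : ℝ) * Complex.I) *
      ((s.indicator f v : ℝ) : ℂ)).re :=
    (Complex.reCLM.integral_comp_comm hint).symm
  rw [Function.comp_apply, Function.comp_apply]
  simp_rw [hfun]
  rw [hre, ← integral_indicator hs]
  congr 1
  funext x
  rw [Complex.re_mul_ofReal, Complex.exp_ofReal_mul_I_re, Real.cos_neg]
  by_cases hx : x ∈ s
  · simp [hx, mul_comm]
  · simp [hx]

theorem hasSum_catalanG :
    HasSum (fun n : ℕ => (-1) ^ n / (2 * n + 1 : ℝ) ^ 2) catalanG := by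
  refine (Summable.of_norm ?_).hasSum
  refine (hasSum_one_div_odd_pow hasSum_one_div_succ_sq).summable.congr fun n => ?_
  rw [norm_div, norm_pow, norm_neg, norm_one, one_pow,
    Real.norm_of_nonneg (by positivity)]

theorem integral_sq_div_sin :
    ∫ x in Ioo 0 (Real.pi / 2), x ^ 2 / Real.sin x =
      2 * Real.pi * catalanG - 7 / 2 * zeta3 := by
  have hpart : ∀ N : ℕ, 2 * ∑ k ∈ Finset.range N,
      (Real.pi * ((-1) ^ k / (2 * k + 1 : ℝ) ^ 2) - 2 * (1 / (2 * k + 1 : ℝ) ^ 3)) =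
      (∫ x in Ioo 0 (Real.pi / 2), x ^ 2 / Real.sin x) -
        ∫ x in Ioo 0 (Real.pi / 2), x ^ 2 / Real.sin x * Real.cos (2 * N * x) := by
    intro N
    have hcos : IntegrableOn (fun x => x ^ 2 / Real.sin x * Real.cos (2 * N * x))
        (Ioo 0 (Real.pi / 2)) := by
      refine integrableOn_Ioo_of_abs_le (by fun_prop) integrableOn_sq_div_sin.abs fun x _ => ?_
      rw [abs_mul]
      exact mul_le_of_le_one_right (abs_nonneg _) (Real.abs_cos_le_one _)
    rw [← integral_sub integrableOn_sq_div_sin hcos]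
    simp_rw [← integral_sq_mul_sin_odd]
    rw [← integral_finsetSum _ fun k _ => ContinuousOn.integrableOn_Ioo (by fun_prop),
      ← integral_const_mul]
    refine setIntegral_congr_fun measurableSet_Ioo fun x hx => ?_
    have hs : Real.sin x ≠ 0 :=
      (Real.sin_pos_of_pos_of_lt_pi hx.1 (by linarith [hx.2, Real.pi_pos])).ne'
    have h := two_mul_sin_mul_sum_sin_odd x N
    rw [← Finset.mul_sum]
    generalize ∑ k ∈ Finset.range N, Real.sin ((2 * k + 1) * x) = S at h ⊢
    have hS : S = (1 - Real.cos (2 * N * x)) / (2 * Real.sin x) := by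
      rw [← h]
      field_simp
    rw [hS]
    field_simp
  have hlim := (tendsto_integral_mul_cos measurableSet_Ioo integrableOn_sq_div_sin).const_sub
    (∫ x in Ioo 0 (Real.pi / 2), x ^ 2 / Real.sin x)
  rw [sub_zero] at hlim
  have hsum := (((hasSum_catalanG.mul_left Real.pi).sub
    ((hasSum_one_div_odd_pow hasSum_zeta3).mul_left 2)).tendsto_sum_nat).const_mul 2
  rw [tendsto_nhds_unique hlim (hsum.congr hpart)]
  ring

theorem integral_arctan_sq_div :
    ∫ t in Ioo (0 : ℝ) 1, Real.arctan t ^ 2 / t = Real.pi * catalanG / 2 - 7 / 8 * zeta3 := by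
  have hcos : ∀ x ∈ Ioo 0 (Real.pi / 2), Real.cos (x / 2) ≠ 0 := fun x hx =>
    (Real.cos_pos_of_mem_Ioo ⟨by linarith [hx.1, Real.pi_pos], by linarith [hx.2, hx.1]⟩).ne'
  have harctan : ∀ x ∈ Ioo 0 (Real.pi / 2), Real.arctan (Real.tan (x / 2)) = x / 2 := fun x hx =>
    Real.arctan_tan (by linarith [hx.1, Real.pi_pos]) (by linarith [hx.2, hx.1])
  have hd : ∀ x ∈ Ioo 0 (Real.pi / 2), HasDerivAt (fun x => Real.tan (x / 2))
      (1 / (2 * Real.cos (x / 2) ^ 2)) x := by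
    intro x hx
    have h := (Real.hasDerivAt_tan (hcos x hx)).comp x ((hasDerivAt_id x).div_const 2)
    refine h.congr_of_forall_eq (fun y => rfl) ?_
    ring
  have hinj : InjOn (fun x => Real.tan (x / 2)) (Ioo 0 (Real.pi / 2)) := by
    intro x hx y hy h
    have h' := congrArg Real.arctan h
    simp only [harctan x hx, harctan y hy] at h'
    linarith
  have himg : (fun x => Real.tan (x / 2)) '' Ioo 0 (Real.pi / 2) = Ioo 0 1 := by
    ext y
    constructor
    · rintro ⟨x, hx, rfl⟩
      refine ⟨Real.tan_pos_of_pos_of_lt_pi_div_two (by linarith [hx.1])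
        (by linarith [hx.2, hx.1]), ?_⟩
      rw [← Real.tan_pi_div_four]
      exact Real.tan_lt_tan_of_nonneg_of_lt_pi_div_two (by linarith [hx.1])
        (by linarith [Real.pi_pos]) (by linarith [hx.2])
    · intro hy
      have h1 := Real.arctan_pos.2 hy.1
      have h2 := Real.arctan_strictMono hy.2
      rw [Real.arctan_one] at h2
      refine ⟨2 * Real.arctan y, ⟨by linarith, by linarith⟩, ?_⟩
      simp only
      rw [mul_div_cancel_left₀ _ two_ne_zero, Real.tan_arctan]
  rw [integral_Ioo_eq_integral_comp measurableSet_Ioo hd hinj himg]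
  have h2 : ∫ x in Ioo 0 (Real.pi / 2), |1 / (2 * Real.cos (x / 2) ^ 2)| *
        (Real.arctan (Real.tan (x / 2)) ^ 2 / Real.tan (x / 2)) =
      ∫ x in Ioo 0 (Real.pi / 2), 1 / 4 * (x ^ 2 / Real.sin x) := by
    refine setIntegral_congr_fun measurableSet_Ioo fun x hx => ?_
    have hc := hcos x hx
    have hs : Real.sin (x / 2) ≠ 0 := (Real.sin_pos_of_pos_of_lt_pi (by linarith [hx.1])
      (by linarith [hx.2, Real.pi_pos])).ne'
    have hsin : Real.sin x = 2 * Real.sin (x / 2) * Real.cos (x / 2) := by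
      rw [← Real.sin_two_mul]; congr 1; ring
    rw [harctan x hx, hsin, Real.tan_eq_sin_div_cos, abs_of_pos (by positivity)]
    field_simp
    ring
  rw [h2, integral_const_mul, integral_sq_div_sin]
  ring

/-! ### Evaluation -/

theorem integral_two_mul_altPolylog_two_zero :
    ∫ t in Ioo (0 : ℝ) 1, 2 * t * altPolylog 2 0 t / (1 + t ^ 2) =
      -(Real.pi * catalanG / 2) + 7 / 4 * zeta3 := by
  have hone : altPolylog 2 0 1 = catalanG := by simp [altPolylog, catalanG]
  have hcont := continuousOn_altPolylog le_rfl 0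
  have hi1 : IntegrableOn (fun t => 2 * t * altPolylog 2 0 t / (1 + t ^ 2)) (Ioo 0 1) :=
    ContinuousOn.integrableOn_Ioo (((continuousOn_const.mul continuousOn_id).mul hcont).div
      (by fun_prop) fun t _ => by positivity)
  have hi2 : IntegrableOn (fun t => 2 * (Real.arctan t ^ 2 / t)) (Ioo 0 1) := by
    refine integrableOn_Ioo_of_abs_le (g := fun t => 2 * t) (by fun_prop)
      (ContinuousOn.integrableOn_Ioo (by fun_prop)) fun t ht => ?_
    have h0 := Real.arctan_pos.2 ht.1
    have h1 : Real.arctan t ≤ t := by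
      simpa only [Real.tan_arctan] using Real.le_tan h0.le (Real.arctan_lt_pi_div_two t)
    have ht0 := ht.1
    rw [abs_of_pos (by positivity)]
    gcongr
    rw [div_le_iff₀ ht0]
    nlinarith
  have h := integral_Ioo_eq_sub (F := fun t => 2 * Real.arctan t * (t * altPolylog 2 0 t))
    zero_le_one ?_ ?_ (hi1.add hi2)
  · have hadd := integral_add hi1 hi2
    simp only [Pi.add_apply] at h
    rw [hadd, integral_const_mul, integral_arctan_sq_div] at h
    simp only [Real.arctan_one, Real.arctan_zero, hone] at h
    linarith
  · exact (continuous_const.mul Real.continuous_arctan).continuousOn.mul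
      (continuousOn_id.mul hcont)
  · intro t ht
    refine (((Real.hasDerivAt_arctan t).const_mul 2).mul
      (hasDerivAt_mul_altPolylog 1 0 ht)).congr_of_forall_eq (fun y => rfl) ?_
    rw [altPolylog_one_zero ht, Pi.add_apply]
    ring

theorem integral_altPolylog_two_one :
    ∫ t in Ioo (0 : ℝ) 1, altPolylog 2 1 t = 3 / 32 * zeta3 := by
  have hone : altPolylog 3 1 1 = 3 / 32 * zeta3 := by
    have h := (hasSum_neg_one_pow_div_pow hasSum_zeta3).mul_left (1 / 8)
    rw [show 1 / 8 * ((1 - 2 / 2 ^ 3) * zeta3) = 3 / 32 * zeta3 by ring] at h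
    refine HasSum.tsum_eq (h.congr_fun fun n => ?_)
    have hn : (n + 1 : ℝ) ≠ 0 := by positivity
    have hn2 : (2 * n + 1 + 1 : ℝ) = 2 * (n + 1) := by ring
    rw [one_pow, Nat.cast_one, hn2]
    field_simp
    ring
  rw [integral_Ioo_eq_sub (F := fun t => t * altPolylog 3 1 t) zero_le_one
    (continuousOn_id.mul (continuousOn_altPolylog (by norm_num) 1))
    (fun t ht => hasDerivAt_mul_altPolylog 2 1 ht)
    (continuousOn_altPolylog le_rfl 1).integrableOn_Ioo, hone]
  ring

theorem altPolylog_two_one_one : altPolylog 2 1 1 = Real.pi ^ 2 / 48 := by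
  have h := (hasSum_neg_one_pow_div_pow hasSum_one_div_succ_sq).mul_left (1 / 4)
  rw [show 1 / 4 * ((1 - 2 / 2 ^ 2) * (Real.pi ^ 2 / 6)) = Real.pi ^ 2 / 48 by ring] at h
  refine HasSum.tsum_eq (h.congr_fun fun n => ?_)
  have hn : (n + 1 : ℝ) ≠ 0 := by positivity
  have hn2 : (2 * n + 1 + 1 : ℝ) = 2 * (n + 1) := by ring
  rw [one_pow, Nat.cast_one, hn2]
  field_simp
  ring

theorem integral_sq_mul_altPolylog_two_one :
    ∫ t in Ioo (0 : ℝ) 1, 2 * t * (t * altPolylog 2 1 t) / (1 + t ^ 2) =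
      Real.log 2 * Real.pi ^ 2 / 48 - zeta3 / 16 := by
  have hcont := continuousOn_altPolylog le_rfl 1
  have hi1 : IntegrableOn (fun t => 2 * t * (t * altPolylog 2 1 t) / (1 + t ^ 2)) (Ioo 0 1) :=
    ContinuousOn.integrableOn_Ioo (((continuousOn_const.mul continuousOn_id).mul
      (continuousOn_id.mul hcont)).div (by fun_prop) fun t _ => by positivity)
  have hi2 : IntegrableOn (fun t => 1 / 2 * (Real.log (1 + t ^ 2) ^ 2 / t)) (Ioo 0 1) := by
    refine integrableOn_Ioo_of_abs_le (g := fun _ => 1) (by fun_prop)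
      (ContinuousOn.integrableOn_Ioo (by fun_prop)) fun t ht => ?_
    have ht0 := ht.1
    have ht1 := ht.2
    have h0 : 0 ≤ Real.log (1 + t ^ 2) := Real.log_nonneg (by nlinarith)
    have h1 : Real.log (1 + t ^ 2) ≤ t ^ 2 := by
      linarith [Real.log_le_sub_one_of_pos (show 0 < 1 + t ^ 2 by positivity)]
    have h2 : t ^ 2 ≤ t := by nlinarith
    have h3 : Real.log (1 + t ^ 2) ^ 2 ≤ t := by nlinarith
    have h4 : Real.log (1 + t ^ 2) ^ 2 / t ≤ 1 := by rwa [div_le_one ht0]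
    rw [abs_of_nonneg (by positivity)]
    linarith
  have h := integral_Ioo_eq_sub (F := fun t => Real.log (1 + t ^ 2) * (t * altPolylog 2 1 t))
    zero_le_one ?_ ?_ (hi1.add hi2)
  · have hadd := integral_add hi1 hi2
    simp only [Pi.add_apply] at h
    rw [hadd, integral_const_mul, integral_log_one_add_sq_sq_div] at h
    norm_num [altPolylog_two_one_one] at h
    linarith
  · exact (ContinuousOn.log (by fun_prop) fun t _ => by positivity).mul
      (continuousOn_id.mul hcont)
  · intro t ht
    have hd : HasDerivAt (fun t : ℝ => 1 + t ^ 2) (2 * t) t := by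
      simpa using (hasDerivAt_pow 2 t).const_add 1
    refine ((hd.log (by positivity)).mul
      (hasDerivAt_mul_altPolylog 1 1 ht)).congr_of_forall_eq (fun y => rfl) ?_
    rw [altPolylog_one_one ht, Pi.add_apply]
    have := ht.1.ne'
    field_simp

theorem integral_log_mul_log_one_add_sq_half_div :
    ∫ x in Ioo (0 : ℝ) 1, Real.log x * Real.log ((1 + x ^ 2) / 2) / (1 - x) =
      2 * zeta3 - Real.pi * catalanG / 2 - Real.pi ^ 2 * Real.log 2 / 48 := by
  have hcont0 := continuousOn_altPolylog le_rfl 0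
  have hcont1 := continuousOn_altPolylog le_rfl 1
  have hi1 : IntegrableOn (fun t => 2 * t * altPolylog 2 0 t / (1 + t ^ 2)) (Ioo 0 1) :=
    ContinuousOn.integrableOn_Ioo (((continuousOn_const.mul continuousOn_id).mul hcont0).div
      (by fun_prop) fun t _ => by positivity)
  have hi2 : IntegrableOn (fun t => 2 * altPolylog 2 1 t) (Ioo 0 1) :=
    ContinuousOn.integrableOn_Ioo (continuousOn_const.mul hcont1)
  have hi3 : IntegrableOn (fun t => 2 * t * (t * altPolylog 2 1 t) / (1 + t ^ 2)) (Ioo 0 1) :=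
    ContinuousOn.integrableOn_Ioo (((continuousOn_const.mul continuousOn_id).mul
      (continuousOn_id.mul hcont1)).div (by fun_prop) fun t _ => by positivity)
  have hsplit : ∀ t : ℝ, (2 * t * altPolylog 2 0 t + 2 * altPolylog 2 1 t) / (1 + t ^ 2) =
      2 * t * altPolylog 2 0 t / (1 + t ^ 2) + (2 * altPolylog 2 1 t -
        2 * t * (t * altPolylog 2 1 t) / (1 + t ^ 2)) := by
    intro t
    have : 1 + t ^ 2 ≠ 0 := by positivity
    field_simp
    ring
  rw [integral_log_mul_log_div_eq_altPolylog]
  simp_rw [hsplit]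
  have h1 := integral_add hi1 (hi2.sub hi3)
  have h2 := integral_sub hi2 hi3
  simp only [Pi.sub_apply] at h1
  rw [h1, h2, integral_const_mul, integral_two_mul_altPolylog_two_zero,
    integral_altPolylog_two_one, integral_sq_mul_altPolylog_two_one]
  ring

theorem integrableOn_log_mul_log_two_sub_div :
    IntegrableOn (fun x => Real.log x * Real.log (2 - x) / (1 - x)) (Ioo 0 1) := by
  refine (integrableOn_unit_comp_one_sub integrableOn_log_one_sub_mul_log_one_add_div).congr_fun
    (fun x _ => ?_) measurableSet_Ioo
  simp only
  rw [show 1 + (1 - x) = 2 - x by ring, sub_sub_cancel]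

theorem integrableOn_log_mul_log_one_add_sq_half_div :
    IntegrableOn (fun x => Real.log x * Real.log ((1 + x ^ 2) / 2) / (1 - x)) (Ioo 0 1) := by
  refine integrableOn_Ioo_of_abs_le (g := fun x => 1 - Real.log x) (by fun_prop)
    ((ContinuousOn.integrableOn_Ioo continuousOn_const).sub integrableOn_log_unit) fun x hx => ?_
  have hx0 := hx.1
  have hx1 : 0 < 1 - x := by linarith [hx.2]
  have hl : |Real.log ((1 + x ^ 2) / 2)| ≤ 1 := by
    have h1 : (1 + x ^ 2) / 2 ≤ 1 := by nlinarith [hx.2]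
    rw [abs_of_nonpos (Real.log_nonpos (by positivity) h1)]
    have h2 : Real.log (1 / 2) ≤ Real.log ((1 + x ^ 2) / 2) :=
      Real.log_le_log (by norm_num) (by nlinarith)
    rw [one_div, Real.log_inv] at h2
    linarith [Real.log_two_lt_d9]
  refine le_trans ?_ (neg_log_div_one_sub_le hx)
  rw [abs_div, abs_mul, abs_of_neg (Real.log_neg hx.1 hx.2), abs_of_pos hx1]
  gcongr
  exact mul_le_of_le_one_right (by linarith [Real.log_neg hx.1 hx.2]) hl

theorem integral_log_mul_log_cubic_div :
    ∫ x in Ioo (0 : ℝ) 1, 2 * Real.log x / (1 - x) * Real.log (1 - x * (1 - x) ^ 2 / 2) =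
      11 * zeta3 / 4 - Real.pi * catalanG - Real.pi ^ 2 * Real.log 2 / 24 := by
  have h := integral_add integrableOn_log_mul_log_two_sub_div
    integrableOn_log_mul_log_one_add_sq_half_div
  rw [integral_log_mul_log_two_sub_div, integral_log_mul_log_one_add_sq_half_div] at h
  have h2 : ∫ x in Ioo (0 : ℝ) 1,
      2 * Real.log x / (1 - x) * Real.log (1 - x * (1 - x) ^ 2 / 2) =
      ∫ x in Ioo (0 : ℝ) 1, 2 * (Real.log x * Real.log (2 - x) / (1 - x) +
        Real.log x * Real.log ((1 + x ^ 2) / 2) / (1 - x)) := by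
    refine setIntegral_congr_fun measurableSet_Ioo fun x hx => ?_
    rw [show 1 - x * (1 - x) ^ 2 / 2 = (2 - x) * ((1 + x ^ 2) / 2) by ring,
      Real.log_mul (by linarith [hx.2]) (by positivity)]
    ring
  rw [h2, integral_const_mul, h]
  ring

theorem sun_inv3k_H3kHk_two :
    ∑' k : ℕ, (harmonicNum (3 * (k + 1)) - harmonicNum (k + 1)) /
        ((k + 1 : ℝ) ^ 2 * 2 ^ (k + 1) * (Nat.choose (3 * (k + 1)) (k + 1) : ℝ)) =
      11 * zeta3 / 4 - Real.pi * catalanG - Real.pi ^ 2 * Real.log 2 / 24 := by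
  rw [tsum_eq_integral_log_mul_log, integral_log_mul_log_cubic_div]
end

section
/- The convergent series ∑_{k=0}^∞ (C(2k,k)/16^k)·H_k^{(2)} equals −(32/√3)·Li₂(2 − √3) − (4/√3)·(log(2+√3))² + 5π²/(3√3), where Li₂(x) = ∑_{n=1}^∞ xⁿ/n² is the dilogarithm. -/
open scoped BigOperators

/-- Second-order harmonic number `H_m^{(2)} = ∑_{j=1}^m 1/j²`. -/
noncomputable def harmonic2 (m : ℕ) : ℝ := ∑ j ∈ Finset.range m, 1 / (j + 1 : ℝ) ^ 2

/-- The real dilogarithm `Li₂(x) = ∑_{n=1}^∞ xⁿ/n²` (for `|x| < 1`). -/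
noncomputable def dilog (x : ℝ) : ℝ := ∑' n : ℕ, x ^ (n + 1) / (n + 1 : ℝ) ^ 2

theorem hasDerivAt_powerSeries_of_bound {c : ℕ → ℝ} {B R : ℝ} (hR : 0 < R)
    (hc : ∀ n, |c n| ≤ B * R ^ n) {x : ℝ} (hx : |x| * R < 1) :
    ∃ d, HasDerivAt (fun y => ∑' n, c n * y ^ n) d x ∧
      HasSum (fun n : ℕ => (n + 1) * c (n + 1) * x ^ n) d ∧
      HasSum (fun n : ℕ => c n * x ^ n) (∑' n, c n * x ^ n) ∧
      HasSum (fun n : ℕ => n * c n * x ^ n) (x * d) := by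
  have hxR : |x| < 1 / R := by rwa [lt_div_iff₀ hR]
  obtain ⟨r, hxr, hrR⟩ := exists_between hxR
  have hr : 0 < r := (abs_nonneg x).trans_lt hxr
  have hRr : R * r < 1 := by rwa [lt_div_iff₀ hR, mul_comm] at hrR
  have hRr0 : 0 < R * r := mul_pos hR hr
  have hu : Summable fun n : ℕ => B / r * ((n : ℝ) ^ 1 * (R * r) ^ n) := by
    have hnorm : ‖R * r‖ < 1 := by rwa [Real.norm_eq_abs, abs_of_pos hRr0]
    exact (summable_pow_mul_geometric_of_norm_lt_one 1 hnorm).mul_left (B / r)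
  have hg : ∀ (n : ℕ) (y : ℝ), y ∈ Metric.ball (0 : ℝ) r →
      HasDerivAt (fun y => c n * y ^ n) (c n * (n * y ^ (n - 1))) y :=
    fun n y _ => (hasDerivAt_pow n y).const_mul (c n)
  have hg' : ∀ (n : ℕ) (y : ℝ), y ∈ Metric.ball (0 : ℝ) r →
      ‖c n * (n * y ^ (n - 1))‖ ≤ B / r * ((n : ℝ) ^ 1 * (R * r) ^ n) := by
    intro n y hy
    have hy' : |y| < r := by simpa using hy
    rcases n with _ | n
    · simp
    · rw [norm_mul, norm_mul, norm_pow, Real.norm_eq_abs, Real.norm_eq_abs, Real.norm_eq_abs,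
        abs_of_nonneg (by positivity : (0 : ℝ) ≤ ((n + 1 : ℕ) : ℝ))]
      have h0 : 0 ≤ B * R ^ (n + 1) := (abs_nonneg _).trans (hc _)
      calc |c (n + 1)| * (((n + 1 : ℕ) : ℝ) * |y| ^ (n + 1 - 1))
          ≤ (B * R ^ (n + 1)) * (((n + 1 : ℕ) : ℝ) * r ^ n) := by
            have := hc (n + 1)
            simp only [Nat.add_sub_cancel]
            gcongr
        _ = _ := by
            rw [mul_pow, pow_succ r]
            field_simp
  have h0 : Summable fun n : ℕ => c n * (0 : ℝ) ^ n :=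
    summable_of_ne_finset_zero (s := {0}) (fun n hn => by
      rw [zero_pow (by simpa using hn), mul_zero])
  have hxb : x ∈ Metric.ball (0 : ℝ) r := by simpa using hxr
  have hconn := (convex_ball (0 : ℝ) r).isPreconnected
  have hder := hasDerivAt_tsum_of_isPreconnected hu Metric.isOpen_ball hconn hg hg'
    (Metric.mem_ball_self hr) h0 hxb
  have hsum : Summable fun n : ℕ => c n * x ^ n :=
    summable_of_summable_hasDerivAt_of_isPreconnected (g := fun n y => c n * y ^ n)
      (g' := fun n y => c n * (n * y ^ (n - 1))) hu Metric.isOpen_ball hconn hg hg'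
      (Metric.mem_ball_self hr) h0 hxb
  have hsum' : Summable fun n : ℕ => c n * (n * x ^ (n - 1)) :=
    Summable.of_norm_bounded hu (fun n => hg' n x hxb)
  have hs := hsum'.hasSum
  refine ⟨_, hder, ?_, hsum.hasSum, ?_⟩
  · have := (hasSum_nat_add_iff' 1).2 hs
    simp only [Finset.sum_range_one, Nat.cast_zero, zero_mul, mul_zero, sub_zero] at this
    refine this.congr_fun fun n => ?_
    rw [Nat.add_sub_cancel]
    push_cast
    ring
  · refine (hs.mul_left x).congr_fun fun n => ?_
    rcases n with _ | n
    · simp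
    · rw [Nat.add_sub_cancel]
      ring

theorem eq_of_hasDerivAt_zero {f : ℝ → ℝ} {b : ℝ} (hb : 0 < b)
    (hc : ContinuousOn f (Set.Icc 0 b)) (h : ∀ x ∈ Set.Ioo 0 b, HasDerivAt f 0 x) :
    f b = f 0 := by
  obtain ⟨c, _, hc'⟩ := exists_hasDerivAt_eq_slope f (fun _ => 0) hb hc h
  rw [eq_comm, div_eq_zero_iff] at hc'
  rcases hc' with h1 | h1 <;> linarith

theorem dilog_eq_tsum {x : ℝ} (hx : |x| < 1) : dilog x = ∑' n : ℕ, 1 / (n : ℝ) ^ 2 * x ^ n := by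
  have hs : Summable fun n : ℕ => 1 / (n : ℝ) ^ 2 * x ^ n := by
    refine Summable.of_norm_bounded hasSum_zeta_two.summable fun n => ?_
    rw [norm_mul, norm_pow, Real.norm_eq_abs, Real.norm_eq_abs, abs_of_nonneg (by positivity)]
    exact mul_le_of_le_one_right (by positivity) (pow_le_one₀ (abs_nonneg x) hx.le)
  rw [hs.tsum_eq_zero_add, dilog]
  simp only [Nat.cast_zero, Nat.cast_add, Nat.cast_one]
  rw [show (1 / (0 : ℝ) ^ 2 * x ^ 0) = 0 by norm_num, zero_add]
  exact tsum_congr fun n => by ring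

theorem hasDerivAt_dilog {x : ℝ} (hx : |x| < 1) (hx0 : x ≠ 0) :
    HasDerivAt dilog (-Real.log (1 - x) / x) x := by
  have hc : ∀ n : ℕ, |1 / (n : ℝ) ^ 2| ≤ 1 * 1 ^ n := by
    intro n
    rw [abs_of_nonneg (by positivity), one_pow, mul_one]
    rcases n with _ | n
    · norm_num
    · rw [div_le_one (by positivity)]
      exact one_le_pow₀ (by push_cast; linarith [n.cast_nonneg (α := ℝ)])
  obtain ⟨d, hd, hs, -, -⟩ := hasDerivAt_powerSeries_of_bound one_pos hc (by rwa [mul_one])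
  have hxd : x * d = -Real.log (1 - x) := by
    refine (hs.mul_left x).unique ?_
    refine (Real.hasSum_pow_div_log_of_abs_lt_one hx).congr_fun fun n => ?_
    rw [pow_succ, Nat.cast_add, Nat.cast_one]
    field_simp
    ring
  rw [← hxd, mul_div_cancel_left₀ _ hx0]
  refine hd.congr_of_eventuallyEq ?_
  filter_upwards [(isOpen_lt continuous_abs continuous_const).mem_nhds hx] with y hy
  exact dilog_eq_tsum hy

theorem continuousOn_dilog : ContinuousOn dilog (Set.Icc 0 1) := by
  have hu : Summable fun n : ℕ => 1 / ((n + 1 : ℕ) : ℝ) ^ 2 :=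
    (summable_nat_add_iff 1).2 hasSum_zeta_two.summable
  refine continuousOn_tsum (fun n => by fun_prop) hu fun n x hx => ?_
  rw [Real.norm_eq_abs, abs_of_nonneg (div_nonneg (pow_nonneg hx.1 _) (by positivity))]
  push_cast
  gcongr
  exact pow_le_one₀ hx.1 hx.2

theorem dilog_zero : dilog 0 = 0 := by simp [dilog]

theorem dilog_one : dilog 1 = Real.pi ^ 2 / 6 := by
  have := (hasSum_nat_add_iff' 1).2 hasSum_zeta_two
  simpa [dilog] using this.tsum_eq

/-- The Rogers dilogarithm. -/
noncomputable def rogersL (x : ℝ) : ℝ := dilog x + Real.log x * Real.log (1 - x) / 2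

theorem rogersL_zero : rogersL 0 = 0 := by simp [rogersL, dilog_zero]

theorem rogersL_one : rogersL 1 = Real.pi ^ 2 / 6 := by simp [rogersL, dilog_one]

theorem hasDerivAt_log_one_sub {x : ℝ} (hx : x < 1) :
    HasDerivAt (fun y => Real.log (1 - y)) (-1 / (1 - x)) x :=
  ((hasDerivAt_id x).const_sub 1).log (by simp only [id]; linarith)

theorem hasDerivAt_rogersL {x : ℝ} (h0 : 0 < x) (h1 : x < 1) :
    HasDerivAt rogersL (-(Real.log (1 - x) / x + Real.log x / (1 - x)) / 2) x := by
  have hd := hasDerivAt_dilog (abs_lt.2 ⟨by linarith, h1⟩) h0.ne'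
  have := hd.add (((Real.hasDerivAt_log h0.ne').mul (hasDerivAt_log_one_sub h1)).div_const 2)
  refine this.congr_deriv ?_
  have : (1 : ℝ) - x ≠ 0 := by linarith
  field_simp
  ring

theorem continuousAt_log_mul_log_one_sub :
    ContinuousAt (fun x : ℝ => Real.log x * Real.log (1 - x)) 0 := by
  have hO : (fun x : ℝ => Real.log (1 - x)) =O[nhds 0] fun x => x := by
    have := (hasDerivAt_log_one_sub (x := 0) one_pos).isBigO_sub
    simpa using this
  have hlim : Filter.Tendsto (fun x : ℝ => Real.log x * x) (nhds 0) (nhds 0) := by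
    have := Real.continuous_mul_log.tendsto 0
    simpa [mul_comm] using this
  have := ((Asymptotics.isBigO_refl Real.log (nhds 0)).mul hO).trans_tendsto hlim
  simpa [ContinuousAt] using this

theorem continuousOn_rogersL : ContinuousOn rogersL (Set.Icc 0 1) := by
  refine continuousOn_dilog.add (ContinuousOn.div_const (fun x hx => ?_) 2)
  apply ContinuousAt.continuousWithinAt
  rcases hx.1.eq_or_lt with rfl | h0
  · exact continuousAt_log_mul_log_one_sub
  rcases hx.2.eq_or_lt with rfl | h1
  · have h : ContinuousAt (fun x : ℝ => 1 - x) 1 := by fun_prop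
    have h' : ContinuousAt (fun x : ℝ => Real.log x * Real.log (1 - x)) (1 - 1) := by
      rw [sub_self]; exact continuousAt_log_mul_log_one_sub
    have := ContinuousAt.comp (x := (1 : ℝ)) (f := fun x : ℝ => 1 - x) h' h
    refine this.congr (Filter.Eventually.of_forall fun y => ?_)
    simp [mul_comm]
  · exact (Real.continuousAt_log h0.ne').mul (hasDerivAt_log_one_sub h1).continuousAt

theorem rogersL_add_rogersL_one_sub {x : ℝ} (h0 : 0 < x) (h1 : x < 1) :
    rogersL x + rogersL (1 - x) = Real.pi ^ 2 / 6 := by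
  have := eq_of_hasDerivAt_zero (f := fun t => rogersL t + rogersL (1 - t)) h0 ?_ ?_
  · simpa [rogersL_zero, rogersL_one] using this
  · refine ContinuousOn.add (continuousOn_rogersL.mono (Set.Icc_subset_Icc_right h1.le))
      (continuousOn_rogersL.comp (by fun_prop) fun t ht => ?_)
    exact ⟨by linarith [ht.2], by linarith [ht.1]⟩
  · intro t ht
    have ht1 : t < 1 := ht.2.trans h1
    have := (hasDerivAt_rogersL ht.1 ht1).add
      ((hasDerivAt_rogersL (x := 1 - t) (by linarith) (by linarith [ht.1])).comp_const_sub 1 t)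
    refine this.congr_deriv ?_
    rw [sub_sub_cancel]
    ring

/-- Abel's five-term relation for the Rogers dilogarithm. -/
theorem rogersL_five_term {x y z u v : ℝ} (hx0 : 0 < x) (hx1 : x < 1) (hy0 : 0 < y) (hy1 : y < 1)
    (hz : z = x * y) (hu : u * (1 - x * y) = x * (1 - y)) (hv : v * (1 - x * y) = y * (1 - x)) :
    rogersL x + rogersL y = rogersL z + rogersL u + rogersL v := by
  have hpos : ∀ t, 0 ≤ t → t < 1 → 0 < 1 - t * y := fun t h0 h1 => by nlinarith
  have hxy := hpos x hx0.le hx1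
  obtain rfl : u = x * (1 - y) / (1 - x * y) := by rw [eq_div_iff hxy.ne', hu]
  obtain rfl : v = y * (1 - x) / (1 - x * y) := by rw [eq_div_iff hxy.ne', hv]
  subst hz
  have := eq_of_hasDerivAt_zero (f := fun t => rogersL t - rogersL (t * y)
    - rogersL (t * (1 - y) / (1 - t * y)) - rogersL (y * (1 - t) / (1 - t * y))) hx0 ?_ ?_
  · simp only [zero_mul, sub_zero, rogersL_zero, mul_one, div_one, zero_sub] at this
    linarith
  · have hne : ∀ t ∈ Set.Icc 0 x, 1 - t * y ≠ 0 := fun t ht =>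
      (hpos t ht.1 (ht.2.trans_lt hx1)).ne'
    refine ((ContinuousOn.sub ?_ (continuousOn_rogersL.comp (by fun_prop) fun t ht => ?_)).sub
      (continuousOn_rogersL.comp ?_ fun t ht => ?_)).sub
      (continuousOn_rogersL.comp ?_ fun t ht => ?_)
    · exact continuousOn_rogersL.mono (Set.Icc_subset_Icc_right hx1.le)
    · have := hpos t ht.1 (ht.2.trans_lt hx1)
      exact ⟨mul_nonneg ht.1 hy0.le, by linarith⟩
    · exact ContinuousOn.div (by fun_prop) (by fun_prop) hne
    · have := hpos t ht.1 (ht.2.trans_lt hx1)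
      have := ht.1
      have := ht.2
      exact ⟨div_nonneg (mul_nonneg ht.1 (by linarith)) (by linarith),
        (div_le_one (by linarith)).2 (by linarith)⟩
    · exact ContinuousOn.div (by fun_prop) (by fun_prop) hne
    · have := hpos t ht.1 (ht.2.trans_lt hx1)
      have := ht.1
      have := ht.2
      exact ⟨div_nonneg (mul_nonneg hy0.le (by linarith)) (by linarith),
        (div_le_one (by linarith)).2 (by linarith)⟩
  · intro t ht
    have h0 : 0 < t := ht.1
    have h1 : t < 1 := ht.2.trans hx1
    have hty := hpos t h0.le h1
    have h1t : 0 < 1 - t := by linarith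
    have h1y : 0 < 1 - y := by linarith
    have hden : HasDerivAt (fun t => 1 - t * y) (-y) t := by
      simpa using ((hasDerivAt_id t).mul_const y).const_sub 1
    have hdz : HasDerivAt (fun t => t * y) y t := by
      simpa using (hasDerivAt_id t).mul_const y
    have hdu := ((hasDerivAt_id t).mul_const (1 - y)).div hden hty.ne'
    have hdv := (((hasDerivAt_id t).const_sub 1).const_mul y).div hden hty.ne'
    simp only [id] at hdu hdv
    have eu : 1 - t * (1 - y) / (1 - t * y) = (1 - t) / (1 - t * y) := by field_simp; ring
    have ev : 1 - y * (1 - t) / (1 - t * y) = (1 - y) / (1 - t * y) := by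
      rw [eq_div_iff hty.ne', sub_mul, div_mul_cancel₀ _ hty.ne']; ring
    have hu1 : t * (1 - y) / (1 - t * y) < 1 := by
      have : 0 < (1 - t) / (1 - t * y) := by positivity
      linarith
    have hv1 : y * (1 - t) / (1 - t * y) < 1 := by
      have : 0 < (1 - y) / (1 - t * y) := by positivity
      linarith
    have h3 := (hasDerivAt_rogersL (by positivity) hu1).comp t hdu
    have h4 := (hasDerivAt_rogersL (by positivity) hv1).comp t hdv
    have h2 := (hasDerivAt_rogersL (x := t * y) (by positivity) (by linarith)).comp t hdz
    refine ((((hasDerivAt_rogersL h0 h1).sub h2).sub h3).sub h4).congr_deriv ?_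
    rw [eu, ev, Real.log_div h1t.ne' hty.ne', Real.log_div h1y.ne' hty.ne',
      Real.log_div (by positivity) hty.ne', Real.log_div (by positivity) hty.ne',
      Real.log_mul h0.ne' h1y.ne', Real.log_mul hy0.ne' h1t.ne', Real.log_mul h0.ne' hy0.ne']
    have := hty.ne'
    have := h1t.ne'
    have := h1y.ne'
    generalize Real.log (1 - t * y) = a
    generalize Real.log (1 - t) = b
    generalize Real.log (1 - y) = c
    generalize Real.log t = e
    generalize Real.log y = f
    generalize hw : 1 - t * y = w at *
    generalize hw' : 1 - t = w' at *
    generalize hw'' : 1 - y = w'' at *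
    obtain rfl : t = 1 - w' := by linarith
    obtain rfl : y = 1 - w'' := by linarith
    field_simp
    subst hw
    ring

theorem rogersL_two_sub_sqrt_three :
    8 * rogersL (2 - √3) + rogersL ((2 - √3) / 4) = 5 * Real.pi ^ 2 / 12 := by
  have hs : √3 ^ 2 = 3 := Real.sq_sqrt (by norm_num)
  have hl : 1.73 < √3 := Real.lt_sqrt_of_sq_lt (by norm_num)
  have hr : √3 < 1.7321 := by rw [Real.sqrt_lt' (by norm_num)]; norm_num
  generalize √3 = s at *
  have a1 := rogersL_five_term (x := s / 2) (y := s - 1) (z := 3 / 2 - s / 2)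
    (u := 3 / 2 - s / 2) (v := 2 - s) (by linarith) (by linarith) (by linarith) (by linarith)
    (by grind) (by grind) (by grind)
  have a2 := rogersL_five_term (x := 1 / 2) (y := 1 - s / 3) (z := 1 / 2 - s / 6)
    (u := s / 2 - 1 / 2) (v := 2 - s) (by linarith) (by linarith) (by linarith) (by linarith)
    (by grind) (by grind) (by grind)
  have a3 := rogersL_five_term (x := 1 / 2 + s / 4) (y := 4 - 2 * s) (z := 1 / 2)
    (u := s / 2) (v := 7 - 4 * s) (by linarith) (by linarith) (by linarith) (by linarith)
    (by grind) (by grind) (by grind)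
  have a4 := rogersL_five_term (x := s / 3) (y := 2 * s - 3) (z := 2 - s)
    (u := 1 - s / 3) (v := 2 - s) (by linarith) (by linarith) (by linarith) (by linarith)
    (by grind) (by grind) (by grind)
  have a5 := rogersL_five_term (x := 1 / 2 + s / 6) (y := 2 - s) (z := 1 / 2 - s / 6)
    (u := s - 1) (v := 7 - 4 * s) (by linarith) (by linarith) (by linarith) (by linarith)
    (by grind) (by grind) (by grind)
  have r1 := rogersL_add_rogersL_one_sub (x := s - 1) (by linarith) (by linarith)
  have r2 := rogersL_add_rogersL_one_sub (x := 3 / 2 - s / 2) (by linarith) (by linarith)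
  have r3 := rogersL_add_rogersL_one_sub (x := 1 / 2) (by linarith) (by linarith)
  have r4 := rogersL_add_rogersL_one_sub (x := 1 / 2 + s / 4) (by linarith) (by linarith)
  have r5 := rogersL_add_rogersL_one_sub (x := s / 3) (by linarith) (by linarith)
  have r6 := rogersL_add_rogersL_one_sub (x := 1 / 2 + s / 6) (by linarith) (by linarith)
  have r7 := rogersL_add_rogersL_one_sub (x := 4 - 2 * s) (by linarith) (by linarith)
  ring_nf at *
  linarith

theorem centralBinom_le_four_pow (k : ℕ) : (k.centralBinom : ℝ) ≤ 4 ^ k := by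
  have h := Nat.choose_le_two_pow (2 * k) k
  rw [← Nat.centralBinom_eq_two_mul_choose, pow_mul] at h
  exact_mod_cast h

theorem succ_mul_centralBinom_succ_cast (k : ℕ) :
    ((k : ℝ) + 1) * ((k + 1).centralBinom : ℝ) = (4 * k + 2) * (k.centralBinom : ℝ) := by
  have h := Nat.succ_mul_centralBinom_succ k
  have h' : (((k + 1) * (k + 1).centralBinom : ℕ) : ℝ) =
    ((2 * (2 * k + 1) * k.centralBinom : ℕ) : ℝ) := by rw [h]
  push_cast at h'
  linear_combination h'

theorem harmonic2_nonneg (k : ℕ) : 0 ≤ harmonic2 k :=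
  Finset.sum_nonneg fun _ _ => by positivity

theorem harmonic2_le (k : ℕ) : harmonic2 k ≤ Real.pi ^ 2 / 6 := by
  have h := (hasSum_nat_add_iff' 1).2 hasSum_zeta_two
  simp only [Finset.sum_range_one, Nat.cast_add, Nat.cast_one, Nat.cast_zero] at h
  norm_num at h
  rw [harmonic2]
  simp only [one_div]
  exact sum_le_hasSum _ (fun _ _ => by positivity) h

theorem abs_mul_one_sub_mul_four_lt_one {w : ℝ} (h0 : 0 ≤ w) (h1 : w < 1 / 2) :
    |w * (1 - w)| * 4 < 1 := by
  rw [abs_of_nonneg (mul_nonneg h0 (by linarith))]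
  nlinarith [sq_pos_of_pos (show 0 < 1 - 2 * w by linarith)]

theorem hasDerivAt_mul_one_sub (w : ℝ) :
    HasDerivAt (fun t : ℝ => t * (1 - t)) (1 - 2 * w) w := by
  refine ((hasDerivAt_id w).mul ((hasDerivAt_id w).const_sub 1)).congr_deriv ?_
  simp only [id]
  ring

theorem hasDerivAt_one_sub_two_mul (w : ℝ) : HasDerivAt (fun t : ℝ => 1 - 2 * t) (-2) w := by
  simpa using ((hasDerivAt_id w).const_mul 2).const_sub 1

theorem tsum_coeff_mul_zero_pow (c : ℕ → ℝ) : ∑' k, c k * (0 : ℝ) ^ k = c 0 := by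
  rw [tsum_eq_single 0 fun n hn => by simp [hn]]
  simp

theorem tsum_centralBinom_mul_pow {w : ℝ} (h0 : 0 < w) (h1 : w < 1 / 2) :
    (1 - 2 * w) * ∑' k : ℕ, (k.centralBinom : ℝ) * (w * (1 - w)) ^ k = 1 := by
  have hb : ∀ k : ℕ, |(k.centralBinom : ℝ)| ≤ 1 * 4 ^ k := fun k => by
    rw [abs_of_nonneg (Nat.cast_nonneg _), one_mul]
    exact centralBinom_le_four_pow k
  have hder : ∀ t, 0 ≤ t → t < 1 / 2 → HasDerivAt
      (fun t => (1 - 2 * t) * ∑' k : ℕ, (k.centralBinom : ℝ) * (t * (1 - t)) ^ k) 0 t := by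
    intro t ht0 ht1
    obtain ⟨d, hd, hs, hA, hxd⟩ := hasDerivAt_powerSeries_of_bound four_pos hb
      (abs_mul_one_sub_mul_four_lt_one ht0 ht1)
    have hode := hs.unique (((hxd.mul_left 4).add (hA.mul_left 2)).congr_fun fun k => by
      rw [succ_mul_centralBinom_succ_cast]; ring)
    refine ((hasDerivAt_one_sub_two_mul t).mul
      (hd.comp t (hasDerivAt_mul_one_sub t))).congr_deriv ?_
    simp only [Function.comp_apply]
    linear_combination hode
  have := eq_of_hasDerivAt_zero h0
    (fun t ht => (hder t ht.1 (ht.2.trans_lt h1)).continuousAt.continuousWithinAt)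
    (fun t ht => hder t ht.1.le (ht.2.trans h1))
  rw [this, zero_mul, tsum_coeff_mul_zero_pow]
  simp

theorem abs_centralBinom_div_le (k : ℕ) : |(k.centralBinom : ℝ) / k| ≤ 1 * 4 ^ k := by
  rw [abs_of_nonneg (by positivity), one_mul]
  rcases k with _ | k
  · simp
  · refine (div_le_self (by positivity) ?_).trans (centralBinom_le_four_pow _)
    push_cast
    linarith [k.cast_nonneg (α := ℝ)]

theorem tsum_centralBinom_div_mul_pow {w : ℝ} (h0 : 0 < w) (h1 : w < 1 / 2) :
    ∑' k : ℕ, (k.centralBinom : ℝ) / k * (w * (1 - w)) ^ k = -2 * Real.log (1 - w) := by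
  have hcont : ∀ t, 0 ≤ t → t < 1 / 2 → ∃ d, HasDerivAt
      (fun t => ∑' k : ℕ, (k.centralBinom : ℝ) / k * (t * (1 - t)) ^ k) (d * (1 - 2 * t)) t ∧
      t * (1 - t) * d = ∑' k : ℕ, (k.centralBinom : ℝ) * (t * (1 - t)) ^ k - 1 := by
    intro t ht0 ht1
    have habs := abs_mul_one_sub_mul_four_lt_one ht0 ht1
    obtain ⟨d, hd, hs, -, -⟩ := hasDerivAt_powerSeries_of_bound four_pos
      abs_centralBinom_div_le habs
    obtain ⟨-, -, -, hA, -⟩ := hasDerivAt_powerSeries_of_bound (B := 1) four_pos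
      (fun k : ℕ => (abs_of_nonneg (Nat.cast_nonneg (α := ℝ) k.centralBinom)).trans_le
        (by rw [one_mul]; exact centralBinom_le_four_pow k)) habs
    have hcomp := hd.comp t (hasDerivAt_mul_one_sub t)
    refine ⟨d, hcomp, ?_⟩
    have hA' := (hasSum_nat_add_iff' 1).2 hA
    simp only [Finset.sum_range_one, pow_zero, Nat.centralBinom_zero, Nat.cast_one,
      mul_one] at hA'
    refine (hs.mul_left _).unique (hA'.congr_fun fun k => ?_)
    push_cast
    field_simp
    ring
  have hlog : ∀ t : ℝ, t < 1 / 2 →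
      HasDerivAt (fun t => 2 * Real.log (1 - t)) (2 * (-1 / (1 - t))) t := fun t ht =>
    (hasDerivAt_log_one_sub (by linarith)).const_mul 2
  have := eq_of_hasDerivAt_zero (f := fun t =>
    ∑' k : ℕ, (k.centralBinom : ℝ) / k * (t * (1 - t)) ^ k + 2 * Real.log (1 - t)) h0 ?_ ?_
  · simp only [zero_mul, tsum_coeff_mul_zero_pow] at this
    simp only [Nat.cast_zero, div_zero, sub_zero, Real.log_one, mul_zero, add_zero] at this
    linarith
  · intro t ht
    obtain ⟨d, hd, -⟩ := hcont t ht.1 (ht.2.trans_lt h1)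
    exact (hd.add (hlog t (ht.2.trans_lt h1))).continuousAt.continuousWithinAt
  · intro t ht
    have ht1 := ht.2.trans h1
    obtain ⟨d, hd, he⟩ := hcont t ht.1.le ht1
    refine (hd.add (hlog t ht1)).congr_deriv ?_
    have hA := tsum_centralBinom_mul_pow ht.1 ht1
    have ht0 : t ≠ 0 := ht.1.ne'
    have h1t : 1 - t ≠ 0 := by linarith
    have key : t * ((1 - t) * (d * (1 - 2 * t)) - 2) = 0 := by
      linear_combination (1 - 2 * t) * he + hA
    have := (mul_eq_zero.1 key).resolve_left ht0
    field_simp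
    linear_combination this

theorem harmonic2_succ (k : ℕ) : harmonic2 (k + 1) = harmonic2 k + 1 / ((k : ℝ) + 1) ^ 2 :=
  Finset.sum_range_succ _ _

theorem tsum_centralBinom_mul_harmonic2_mul_pow {w : ℝ} (h0 : 0 < w) (h1 : w < 1 / 2) :
    (1 - 2 * w) * ∑' k : ℕ, (k.centralBinom : ℝ) * harmonic2 k * (w * (1 - w)) ^ k =
      2 * dilog w + Real.log (1 - w) ^ 2 := by
  have hb : ∀ k : ℕ, |(k.centralBinom : ℝ) * harmonic2 k| ≤ Real.pi ^ 2 / 6 * 4 ^ k := fun k => by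
    rw [abs_of_nonneg (mul_nonneg (Nat.cast_nonneg _) (harmonic2_nonneg k)), mul_comm]
    exact mul_le_mul (harmonic2_le k) (centralBinom_le_four_pow k) (Nat.cast_nonneg _)
      (by positivity)
  have hG : ∀ t, 0 ≤ t → t < 1 / 2 → ∃ d, HasDerivAt
      (fun t => ∑' k : ℕ, (k.centralBinom : ℝ) * harmonic2 k * (t * (1 - t)) ^ k)
        (d * (1 - 2 * t)) t ∧
      t * (1 - t) * d = 4 * (t * (1 - t)) * (t * (1 - t) * d)
        + 2 * (t * (1 - t)) *
          ∑' k : ℕ, (k.centralBinom : ℝ) * harmonic2 k * (t * (1 - t)) ^ k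
        + ∑' k : ℕ, (k.centralBinom : ℝ) / k * (t * (1 - t)) ^ k := by
    intro t ht0 ht1
    have habs := abs_mul_one_sub_mul_four_lt_one ht0 ht1
    obtain ⟨d, hd, hs, hA, hxd⟩ := hasDerivAt_powerSeries_of_bound four_pos hb habs
    obtain ⟨-, -, -, hL, -⟩ := hasDerivAt_powerSeries_of_bound four_pos
      abs_centralBinom_div_le habs
    have hcomp := hd.comp t (hasDerivAt_mul_one_sub t)
    refine ⟨d, hcomp, ?_⟩
    have hL' := (hasSum_nat_add_iff' 1).2 hL
    simp only [Finset.sum_range_one, Nat.cast_zero, div_zero, zero_mul, sub_zero] at hL'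
    refine (hs.mul_left _).unique ((((hxd.mul_left _).add (hA.mul_left _)).add hL').congr_fun
      fun k => ?_)
    have hrec := succ_mul_centralBinom_succ_cast k
    have hk : (k : ℝ) + 1 ≠ 0 := by positivity
    rw [harmonic2_succ, mul_add]
    push_cast
    have hdiv : ((k : ℝ) + 1) * (((k + 1).centralBinom : ℝ) * (1 / ((k : ℝ) + 1) ^ 2)) =
      ((k + 1).centralBinom : ℝ) / (k + 1) := by field_simp
    generalize t * (1 - t) = x
    linear_combination x ^ (k + 1) * harmonic2 k * hrec + x ^ (k + 1) * hdiv
  have hlog : ∀ t : ℝ, t < 1 / 2 →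
      HasDerivAt (fun t => Real.log (1 - t) ^ 2) (2 * Real.log (1 - t) * (-1 / (1 - t))) t :=
    fun t ht => ((hasDerivAt_log_one_sub (by linarith)).pow 2).congr_deriv (by simp)
  have := eq_of_hasDerivAt_zero (f := fun t =>
    (1 - 2 * t) * ∑' k : ℕ, (k.centralBinom : ℝ) * harmonic2 k * (t * (1 - t)) ^ k
      - 2 * dilog t - Real.log (1 - t) ^ 2) h0 ?_ ?_
  · simp only [zero_mul, tsum_coeff_mul_zero_pow, dilog_zero] at this
    simp only [harmonic2, Finset.range_zero, Finset.sum_empty, sub_zero, Real.log_one, mul_zero,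
      ne_eq, OfNat.ofNat_ne_zero, not_false_eq_true, zero_pow] at this
    simp only [harmonic2]
    linarith
  · refine (ContinuousOn.sub (fun t ht => ?_) (continuousOn_const.mul (continuousOn_dilog.mono
      (Set.Icc_subset_Icc_right (by linarith))))).sub fun t ht => ?_
    · obtain ⟨d, hd, -⟩ := hG t ht.1 (ht.2.trans_lt h1)
      exact ((hasDerivAt_one_sub_two_mul t).mul hd).continuousAt.continuousWithinAt
    · exact (hlog t (ht.2.trans_lt h1)).continuousAt.continuousWithinAt
  · intro t ht
    have ht1 := ht.2.trans h1
    have ht0 : t ≠ 0 := ht.1.ne'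
    have h1t : 1 - t ≠ 0 := by linarith
    obtain ⟨d, hd, he⟩ := hG t ht.1.le ht1
    have hdil := hasDerivAt_dilog (x := t) (abs_lt.2 ⟨by linarith [ht.1], by linarith⟩) ht0
    refine ((((hasDerivAt_one_sub_two_mul t).mul hd).sub (hdil.const_mul 2)).sub
      (hlog t ht1)).congr_deriv ?_
    rw [tsum_centralBinom_div_mul_pow ht.1 ht1] at he
    field_simp
    linear_combination he

theorem sun_2k_16_Hk2 :
    ∑' k : ℕ, ((Nat.choose (2 * k) k : ℝ) / 16 ^ k) * harmonic2 k =
      -(32 / Real.sqrt 3) * dilog (2 - Real.sqrt 3) -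
        (4 / Real.sqrt 3) * Real.log (2 + Real.sqrt 3) ^ 2 +
        5 * Real.pi ^ 2 / (3 * Real.sqrt 3) := by
  have hs : √3 ^ 2 = 3 := Real.sq_sqrt (by norm_num)
  have hl : 1.73 < √3 := Real.lt_sqrt_of_sq_lt (by norm_num)
  have hr : √3 < 1.7321 := by rw [Real.sqrt_lt' (by norm_num)]; norm_num
  have hL := rogersL_two_sub_sqrt_three
  have hG := tsum_centralBinom_mul_harmonic2_mul_pow (w := (2 - √3) / 4) (by linarith)
    (by linarith)
  have hsum : ∑' k : ℕ, (k.centralBinom : ℝ) * harmonic2 k *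
      ((2 - √3) / 4 * (1 - (2 - √3) / 4)) ^ k =
      ∑' k : ℕ, ((Nat.choose (2 * k) k : ℝ) / 16 ^ k) * harmonic2 k := by
    have hx : (2 - √3) / 4 * (1 - (2 - √3) / 4) = 1 / 16 := by linear_combination -hs / 16
    rw [hx]
    refine tsum_congr fun k => ?_
    rw [Nat.centralBinom_eq_two_mul_choose, div_pow, one_pow]
    ring
  rw [hsum] at hG
  generalize ∑' k : ℕ, ((Nat.choose (2 * k) k : ℝ) / 16 ^ k) * harmonic2 k = S at hG ⊢
  have hq : 0 < 2 - √3 := by linarith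
  have hinv : 2 + √3 = (2 - √3)⁻¹ := eq_inv_of_mul_eq_one_left (by linear_combination -hs)
  have hlog_inv : Real.log (2 + √3) = -Real.log (2 - √3) := by rw [hinv, Real.log_inv]
  have hlog4 : Real.log 4 = 2 * Real.log 2 := by
    rw [show (4 : ℝ) = 2 ^ 2 by norm_num, Real.log_pow]; norm_num
  have hlog1 : 2 * Real.log (1 - (2 - √3)) = Real.log 2 + Real.log (2 - √3) := by
    rw [← Real.log_mul two_ne_zero hq.ne',
      show 2 * (2 - √3) = (1 - (2 - √3)) ^ 2 by linear_combination -hs, Real.log_pow]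
    norm_num
  have hlog2 : Real.log ((2 - √3) / 4) = Real.log (2 - √3) - 2 * Real.log 2 := by
    rw [Real.log_div hq.ne' four_ne_zero, hlog4]
  have hlog3 : Real.log (1 - (2 - √3) / 4) = -Real.log (2 - √3) - 2 * Real.log 2 := by
    rw [show 1 - (2 - √3) / 4 = (2 + √3) / 4 by ring,
      Real.log_div (by linarith) four_ne_zero, hlog_inv, hlog4]
  simp only [rogersL] at hL
  rw [hlog2, hlog3] at hL
  rw [hlog3] at hG
  rw [hlog_inv]
  have hpos : √3 ≠ 0 := by linarith
  field_simp
  linear_combination 6 * hG + 12 * hL - 24 * Real.log (2 - √3) * hlog1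
end
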